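/- arXiv:2312.01868 — 2 statements merged into one kernel-verified Lean document; each statement's English description precedes it below -/
import Mathlib

section
/- Let C₁, C₂ ⊂ ℙ²(ℂ) be smooth conics intersecting transversely, C = C₁ + C₂, let T₁, T₂, T₃, T₄ be the four common bitangent lines with tangency points P_{ik} = T_i ∩ C_k, and for i ≠ j set ℱ_{ij} = 𝒪_{ℙ²}(1)|_C ⊗ 𝒪_C(−P_{i1} − P_{i2} − P_{j1} − P_{j2}). Then for any partition {i, j, k, l} = {1, 2, 3, 4} one has ℱ_{ij} ≅ ℱ_{kl}. -/
/-!
Basic setup: the complex projective plane, plane curves, conic-line arrangements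
with simple nodes, topological double covers and gluing data.
-/

open MvPolynomial

noncomputable section

/-- The complex projective plane `ℙ²(ℂ)`. -/
abbrev P2 : Type := Projectivization ℂ (Fin 3 → ℂ)

/-- The quotient topology on `ℙ²(ℂ)` (quotient of `ℂ³ ∖ {0}`). -/
instance : TopologicalSpace P2 :=
  (inferInstance : TopologicalSpace (Quotient (projectivizationSetoid ℂ (Fin 3 → ℂ))))

/-- Evaluation of a polynomial at (the chosen representative of) a point of `ℙ²`. -/
def pev (g : MvPolynomial (Fin 3) ℂ) (x : P2) : ℂ :=
  MvPolynomial.eval x.rep g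

/-- The zero locus in `ℙ²(ℂ)` of a (homogeneous) polynomial. -/
def zeroLocus (g : MvPolynomial (Fin 3) ℂ) : Set P2 :=
  {x : P2 | pev g x = 0}

/-- A conic-line arrangement with simple nodes `C = C₁ + ⋯ + C_k` in `ℙ²(ℂ)`:
each component is (the zero locus of) a nonzero homogeneous polynomial of degree 1 (a line)
or 2, smooth (so a degree 2 component is a smooth conic), the components are pairwise
distinct, and all intersection points are ordinary double points: every singular point lies
on exactly two components, whose tangent directions there are distinct (transversal
intersection). -/
structure ConicLineArrangement (k : ℕ) where
  f : Fin k → MvPolynomial (Fin 3) ℂ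
  deg : Fin k → ℕ
  deg_one_or_two : ∀ i, deg i = 1 ∨ deg i = 2
  homog : ∀ i, (f i).IsHomogeneous (deg i)
  ne_zero : ∀ i, f i ≠ 0
  smooth : ∀ i, ∀ x : P2, pev (f i) x = 0 → ∃ m : Fin 3, pev (pderiv m (f i)) x ≠ 0
  distinct : ∀ i j, i ≠ j → zeroLocus (f i) ≠ zeroLocus (f j)
  nodes : ∀ i j, i ≠ j → ∀ x ∈ zeroLocus (f i) ∩ zeroLocus (f j),
    (∀ l, x ∈ zeroLocus (f l) → l = i ∨ l = j) ∧
    ¬ ∃ c : ℂ, ∀ m : Fin 3, pev (pderiv m (f j)) x = c * pev (pderiv m (f i)) x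

namespace ConicLineArrangement

variable {k : ℕ}

/-- The `i`-th irreducible component `C_i` of the arrangement, as a subset of `ℙ²`. -/
def curve (A : ConicLineArrangement k) (i : Fin k) : Set P2 := zeroLocus (A.f i)

/-- The support of the arrangement: the curve `C = C₁ + ⋯ + C_k` as a subset of `ℙ²`. -/
def plane (A : ConicLineArrangement k) : Set P2 := ⋃ i, A.curve i

/-- The set `Sing(C)` of singular points of the arrangement, i.e. its nodes:
the points lying on (at least) two distinct components. -/
def sing (A : ConicLineArrangement k) : Set P2 :=
  {x : P2 | ∃ i j, i ≠ j ∧ x ∈ A.curve i ∧ x ∈ A.curve j}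

end ConicLineArrangement

/-- A topological double cover: a covering map all of whose fibers have exactly
two points. -/
def IsDoubleCover {E X : Type*} [TopologicalSpace E] [TopologicalSpace X] (φ : E → X) : Prop :=
  IsCoveringMap φ ∧ ∀ x : X, Nat.card (φ ⁻¹' {x}) = 2

/-- `SplitsOver φ S x`: the subset `S` of the total space of `φ : C' → C` is mapped
homeomorphically onto the subset `x` of `C`, i.e. `φ` restricted to `S` is a topological
embedding with image (the subtype corresponding to) `x`. -/
def SplitsOver {E X : Type*} [TopologicalSpace E] [TopologicalSpace X]
    (φ : E → X) (S : Set E) (x : Set X) : Prop :=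
  Topology.IsEmbedding (fun y : S => φ (y : E)) ∧ Set.range (fun y : S => φ (y : E)) = x


section GluingData

variable {k : ℕ}

/-- A gluing data of order two on the arrangement `C`: a map `Sing(C) → {+,-}`
(`true` stands for `+`, `false` for `-`). -/
def GluingData (A : ConicLineArrangement k) : Type := {Q : P2 // Q ∈ A.sing} → Bool

open Classical in
/-- The operation on gluing data reversing all the signs at the nodes lying on the
component `C_i`. -/
def flipAt (A : ConicLineArrangement k) (i : Fin k) (κ : GluingData A) : GluingData A :=
  fun Q => if (Q : P2) ∈ A.curve i then !(κ Q) else κ Q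

/-- Two gluing data are equivalent if one is obtained from the other by a finite number of
sign-reversal operations along components. -/
def GluingEquiv (A : ConicLineArrangement k) : GluingData A → GluingData A → Prop :=
  Relation.ReflTransGen (fun κ κ' => ∃ i, κ' = flipAt A i κ)

/-- A labeling of a topological double cover `φ` of the arrangement `C`: a choice, for each
irreducible component `C_i`, of a decomposition `φ⁻¹(C_i) = C_i⁺ ∪ C_i⁻` into two disjoint
subsets, each mapped homeomorphically onto `C_i`. -/
def IsLabeling {C' : Type} [TopologicalSpace C'] (A : ConicLineArrangement k)
    (φ : C' → {x : P2 // x ∈ A.plane}) (piece : Fin k → Bool → Set C') : Prop :=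
  (∀ i, piece i true ∩ piece i false = ∅) ∧
  (∀ i, piece i true ∪ piece i false = φ ⁻¹' {x | (x : P2) ∈ A.curve i}) ∧
  (∀ i ε, SplitsOver (fun y => ((φ y : {x : P2 // x ∈ A.plane}) : P2)) (piece i ε) (A.curve i))

/-- `κ` is the gluing data of the topological double cover `φ` (with respect to some labeling
`C_i⁺`, `C_i⁻` of the halves of the preimages of the components): at a node `Q ∈ C_i ∩ C_j`,
`κ(Q) = +` precisely when `C_i⁺` intersects `C_j⁺` over `Q`. -/
def IsGluingDataOf {C' : Type} [TopologicalSpace C'] (A : ConicLineArrangement k)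
    (φ : C' → {x : P2 // x ∈ A.plane}) (κ : GluingData A) : Prop :=
  ∃ piece : Fin k → Bool → Set C', IsLabeling A φ piece ∧
    ∀ (Q : {Q : P2 // Q ∈ A.sing}) (i j : Fin k), i ≠ j →
      (Q : P2) ∈ A.curve i → (Q : P2) ∈ A.curve j →
      (κ Q = true ↔ ∃ y, y ∈ piece i true ∧ y ∈ piece j true ∧
        ((φ y : {x : P2 // x ∈ A.plane}) : P2) = (Q : P2))

/-- A topological double cover of the arrangement `C`, bundled. -/
structure DoubleCoverOf (A : ConicLineArrangement k) where
  total : Type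
  topo : TopologicalSpace total
  map : total → {x : P2 // x ∈ A.plane}
  is_cover : IsDoubleCover (X := {x : P2 // x ∈ A.plane}) map

attribute [instance] DoubleCoverOf.topo

/-- Two topological double covers of `C` are homeomorphic over `C` if there is a
homeomorphism of total spaces commuting with the covering maps. -/
def HomeoOver {A : ConicLineArrangement k} (D D' : DoubleCoverOf A) : Prop :=
  ∃ h : D.total ≃ₜ D'.total, ∀ y, D'.map (h y) = D.map y

end GluingData

/-!
Algebraic line bundles (invertible sheaves) on a curve `C ⊆ ℙ²(ℂ)`, presented by Čech data:
a cover of `C` by complements of zero loci of homogeneous polynomials, together with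
transition functions which are restrictions of rational functions on `ℙ²` (ratios of
homogeneous polynomials of the same degree), regular and nonvanishing on the overlaps.
Every invertible sheaf on a closed curve in `ℙ²` arises this way, since the distinguished
open subsets form a basis of the Zariski topology and the regular functions on such a subset
of `C` are precisely the restrictions of rational functions on `ℙ²` regular there.
-/

section Bundles

/-- Čech data for an invertible sheaf on a curve `C ⊆ ℙ²(ℂ)`: trivializing charts are the
subsets of `C` where the homogeneous polynomial `H a` does not vanish, and the transition
function from chart `b` to chart `a` is the degree-zero rational function
`num a b / den a b`. -/
structure BundleData (C : Set P2) where
  ι : Type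
  H : ι → MvPolynomial (Fin 3) ℂ
  Hdeg : ι → ℕ
  num : ι → ι → MvPolynomial (Fin 3) ℂ
  den : ι → ι → MvPolynomial (Fin 3) ℂ
  tdeg : ι → ι → ℕ

namespace BundleData

variable {C : Set P2}

/-- Validity of Čech data for an invertible sheaf: the `H a` are homogeneous and their
nonvanishing sets cover `C`; the transition functions are degree-zero rational functions,
regular and nonvanishing on the overlaps (inside `C`), and they satisfy the cocycle
condition (written multiplied out, to avoid division). -/
def Valid (L : BundleData C) : Prop :=
  (∀ a, (L.H a).IsHomogeneous (L.Hdeg a)) ∧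
  (∀ x ∈ C, ∃ a, pev (L.H a) x ≠ 0) ∧
  (∀ a b, (L.num a b).IsHomogeneous (L.tdeg a b) ∧ (L.den a b).IsHomogeneous (L.tdeg a b)) ∧
  (∀ a b, ∀ x ∈ C, pev (L.H a) x ≠ 0 → pev (L.H b) x ≠ 0 →
    pev (L.num a b) x ≠ 0 ∧ pev (L.den a b) x ≠ 0) ∧
  (∀ a b c, ∀ x ∈ C, pev (L.H a) x ≠ 0 → pev (L.H b) x ≠ 0 → pev (L.H c) x ≠ 0 →
    pev (L.num a b) x * pev (L.num b c) x * pev (L.den a c) x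
      = pev (L.num a c) x * pev (L.den a b) x * pev (L.den b c) x)

/-- The value at `x` of the transition function from chart `b` to chart `a`. -/
def gval (L : BundleData C) (a b : L.ι) (x : P2) : ℂ :=
  pev (L.num a b) x / pev (L.den a b) x

/-- Restriction of an invertible sheaf to a subcurve `S ⊆ C` (same Čech data). -/
def restrict (L : BundleData C) (S : Set P2) : BundleData S :=
  ⟨L.ι, L.H, L.Hdeg, L.num, L.den, L.tdeg⟩

/-- Tensor product of invertible sheaves (product of the Čech data). -/
def tensor (L M : BundleData C) : BundleData C where
  ι := L.ι × M.ι
  H p := L.H p.1 * M.H p.2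
  Hdeg p := L.Hdeg p.1 + M.Hdeg p.2
  num p q := L.num p.1 q.1 * M.num p.2 q.2
  den p q := L.den p.1 q.1 * M.den p.2 q.2
  tdeg p q := L.tdeg p.1 q.1 + M.tdeg p.2 q.2

/-- The dual (inverse) of an invertible sheaf: invert the transition functions. -/
def dual (L : BundleData C) : BundleData C :=
  ⟨L.ι, L.H, L.Hdeg, L.den, L.num, L.tdeg⟩

end BundleData

/-- The structure sheaf `𝒪_C` as Čech data: one chart, transition function `1`. -/
def trivBundle (C : Set P2) : BundleData C :=
  ⟨Unit, fun _ => 1, fun _ => 0, fun _ _ => 1, fun _ _ => 1, fun _ _ => 0⟩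

/-- The restriction `𝒪_{ℙ²}(d)|_C`: charts are the standard coordinate charts,
with transition functions `g_{ab} = (X b / X a)^d` (so that a homogeneous polynomial `G` of degree `d` gives the global section with components `G / X_a^d`). -/
def OdC (C : Set P2) (d : ℕ) : BundleData C where
  ι := Fin 3
  H a := MvPolynomial.X a
  Hdeg _ := 1
  num _ b := MvPolynomial.X b ^ d
  den a _ := MvPolynomial.X a ^ d
  tdeg _ _ := d

/-- Data of a trivialization of (equivalently, of a nowhere vanishing section of, or of a
section of) an invertible sheaf `L` on `C`: a refined cover by complements of zero loci of
the `K c`, a map `toChart` sending each refined chart into a chart of `L`, and on each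
refined chart a degree-zero rational function `lnum c / lden c` (the component of the
section in the chart `toChart c`). -/
structure TrivData {C : Set P2} (L : BundleData C) where
  σ : Type
  K : σ → MvPolynomial (Fin 3) ℂ
  Kdeg : σ → ℕ
  toChart : σ → L.ι
  lnum : σ → MvPolynomial (Fin 3) ℂ
  lden : σ → MvPolynomial (Fin 3) ℂ
  ldeg : σ → ℕ

namespace TrivData

variable {C : Set P2} {L : BundleData C}

/-- The value at `x` of the component of the section on the refined chart `c`. -/
def lval (T : TrivData L) (c : T.σ) (x : P2) : ℂ :=
  pev (T.lnum c) x / pev (T.lden c) x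

/-- `T` is a valid global section of `L`: the refined charts cover `C` and lie inside the
corresponding charts of `L`, the components are degree-zero rational functions regular on
the refined charts, with nonvanishing denominators, and they transform via the transition
functions of `L` (written multiplied out). -/
def ValidSection (T : TrivData L) : Prop :=
  (∀ c, (T.K c).IsHomogeneous (T.Kdeg c)) ∧
  (∀ x ∈ C, ∃ c, pev (T.K c) x ≠ 0) ∧
  (∀ c, ∀ x ∈ C, pev (T.K c) x ≠ 0 → pev (L.H (T.toChart c)) x ≠ 0) ∧
  (∀ c, (T.lnum c).IsHomogeneous (T.ldeg c) ∧ (T.lden c).IsHomogeneous (T.ldeg c)) ∧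
  (∀ c, ∀ x ∈ C, pev (T.K c) x ≠ 0 → pev (T.lden c) x ≠ 0) ∧
  (∀ c c', ∀ x ∈ C, pev (T.K c) x ≠ 0 → pev (T.K c') x ≠ 0 →
    pev (L.num (T.toChart c) (T.toChart c')) x * pev (T.lnum c') x * pev (T.lden c) x
      = pev (L.den (T.toChart c) (T.toChart c')) x * pev (T.lden c') x * pev (T.lnum c) x)

/-- `T` is a valid trivialization of `L`: a global section which moreover vanishes
nowhere on `C`. -/
def Valid (T : TrivData L) : Prop :=
  T.ValidSection ∧ ∀ c, ∀ x ∈ C, pev (T.K c) x ≠ 0 → pev (T.lnum c) x ≠ 0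

end TrivData

/-- An invertible sheaf is trivial if it admits a nowhere vanishing global section. -/
def IsTrivial {C : Set P2} (L : BundleData C) : Prop :=
  ∃ T : TrivData L, T.Valid

/-- Two invertible sheaves on `C` are isomorphic iff `L ⊗ M^∨` is trivial. -/
def BIso {C : Set P2} (L M : BundleData C) : Prop :=
  IsTrivial (L.tensor M.dual)

/-- An invertible sheaf has order two (in the sense `ℱ ⊗ ℱ ≅ 𝒪_C`). -/
def IsOrderTwo {C : Set P2} (L : BundleData C) : Prop :=
  BIso (L.tensor L) (trivBundle C)

end Bundles

section SheafGluing

/-- The sign `±1 ∈ ℂ` attached to an element of `{+,-}` (`true` is `+`). -/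
def signC (b : Bool) : ℂ := if b then 1 else -1

/-- `κ` is the gluing data of the invertible sheaf `L` of order two on the conic-line
arrangement `C = C₁ + ⋯ + C_k`: there are trivializations of the restrictions `L|_{C_i}`
such that at each node `Q ∈ C_i ∩ C_j` the two trivializing sections, compared in any chart
of `L` at `Q`, differ by the factor `+1` if `κ(Q) = +` and `-1` if `κ(Q) = -`. -/
def IsSheafGluingDataOf {k : ℕ} (A : ConicLineArrangement k)
    (L : BundleData A.plane) (κ : GluingData A) : Prop :=
  ∃ T : (i : Fin k) → TrivData (L.restrict (A.curve i)),
    (∀ i, (T i).Valid) ∧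
    ∀ (Q : {Q : P2 // Q ∈ A.sing}) (i j : Fin k), i ≠ j →
      (Q : P2) ∈ A.curve i → (Q : P2) ∈ A.curve j →
      ∀ a : L.ι, pev (L.H a) (Q : P2) ≠ 0 →
      ∀ (c : (T i).σ) (c' : (T j).σ),
        pev ((T i).K c) (Q : P2) ≠ 0 → pev ((T j).K c') (Q : P2) ≠ 0 →
        (L.restrict (A.curve i)).gval a ((T i).toChart c) (Q : P2) * (T i).lval c (Q : P2)
          = signC (κ Q) *
            ((L.restrict (A.curve j)).gval a ((T j).toChart c') (Q : P2)
              * (T j).lval c' (Q : P2))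

end SheafGluing

section Divisors

/-- The homogeneous ideal of a point `P ∈ ℙ²(ℂ)`: the ideal generated by the linear forms
vanishing at `P`. -/
def pointIdeal (P : P2) : Ideal (MvPolynomial (Fin 3) ℂ) :=
  Ideal.span {l : MvPolynomial (Fin 3) ℂ | l.IsHomogeneous 1 ∧ pev l P = 0}

/-- `OrdGE f P G m`: on the curve `{f = 0}`, the restriction of the homogeneous polynomial
`G` vanishes to order at least `m` at the point `P`: after multiplying by some homogeneous
polynomial nonvanishing at `P` (i.e. a unit in the local ring of `ℙ²` at `P`), `G` belongs
to the ideal generated by `f` and the `m`-th power of the homogeneous ideal of `P`. -/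
def OrdGE (f : MvPolynomial (Fin 3) ℂ) (P : P2) (G : MvPolynomial (Fin 3) ℂ) (m : ℕ) : Prop :=
  ∃ (Hl : MvPolynomial (Fin 3) ℂ) (e : ℕ), Hl.IsHomogeneous e ∧ pev Hl P ≠ 0 ∧
    Hl * G ∈ Ideal.span {f} ⊔ pointIdeal P ^ m

/-- `OrdEq f P G m`: on the curve `{f = 0}`, the restriction of `G` vanishes to order
exactly `m` at `P`. -/
def OrdEq (f : MvPolynomial (Fin 3) ℂ) (P : P2) (G : MvPolynomial (Fin 3) ℂ) (m : ℕ) : Prop :=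
  OrdGE f P G m ∧ ¬ OrdGE f P G (m + 1)

/-- The divisor of the global section `s` of an invertible sheaf on the curve
`C = {f = 0}` equals the effective divisor `D` (a finitely supported function `ℙ² →₀ ℕ`):
at every point `P` of `C`, in any chart of `s` at `P`, the numerator of the component of
`s` vanishes on `C` to order exactly `D P` at `P` (the denominator does not vanish at `P`). -/
def DivisorOfSectionEq (C : Set P2) (f : MvPolynomial (Fin 3) ℂ) {L : BundleData C}
    (s : TrivData L) (D : P2 →₀ ℕ) : Prop :=
  (∀ P : P2, D P ≠ 0 → P ∈ C) ∧
  ∀ P ∈ C, ∀ c : s.σ, pev (s.K c) P ≠ 0 → OrdEq f P (s.lnum c) (D P)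

/-- The invertible sheaf `L` on the curve `C = {f = 0}` has a global section with divisor
exactly `D`; equivalently, `L ≅ 𝒪_C(D)`. -/
def HasSectionWithDivisor (C : Set P2) (f : MvPolynomial (Fin 3) ℂ)
    (L : BundleData C) (D : P2 →₀ ℕ) : Prop :=
  ∃ s : TrivData L, s.ValidSection ∧ DivisorOfSectionEq C f s D

/-- `L ≅ 𝒪_{ℙ²}(d)|_C ⊗ 𝒪_C(-D)`: the invertible sheaf `L^∨ ⊗ 𝒪(d)|_C` on `C = {f = 0}`
has a global section with divisor exactly `D`. -/
def RepOdMinus (C : Set P2) (f : MvPolynomial (Fin 3) ℂ) (d : ℕ)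
    (L : BundleData C) (D : P2 →₀ ℕ) : Prop :=
  HasSectionWithDivisor C f ((L.dual).tensor (OdC C d)) D

/-- The dualizing sheaf of a reduced plane curve `C ⊂ ℙ²` of degree `m`: by adjunction it is
`ω_C = 𝒪_{ℙ²}(m - 3)|_C`. -/
def planeCurveDualizing (C : Set P2) (m : ℕ) : BundleData C := OdC C (m - 3)

end Divisors

section Tangency

/-- The line `{l = 0}` is tangent to the curve `{g = 0}` at the point `P`: `P` lies on both
and the gradients are proportional there. -/
def IsTangentLineAt (l g : MvPolynomial (Fin 3) ℂ) (P : P2) : Prop :=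
  pev l P = 0 ∧ pev g P = 0 ∧
  ∃ c : ℂ, ∀ m : Fin 3, pev (MvPolynomial.pderiv m g) P = c * pev (MvPolynomial.pderiv m l) P

open Classical in
/-- `D` is the divisor `w·P_{i1} + w·P_{i2}` for the tangency points `P_{ik}` of the
bitangent line `T_i`. -/
def IsTangencyDivisorAt (Pt : Fin 4 → Fin 2 → P2) (i : Fin 4) (w : ℕ) (D : P2 →₀ ℕ) : Prop :=
  ∀ P : P2, D P = (if P = Pt i 0 then w else 0) + (if P = Pt i 1 then w else 0)

open Classical in
/-- `D` is the divisor `P_{i1} + P_{i2} + P_{j1} + P_{j2}` of the tangency points of the two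
bitangent lines `T_i`, `T_j`. -/
def IsTangencyDivisor (Pt : Fin 4 → Fin 2 → P2) (i j : Fin 4) (D : P2 →₀ ℕ) : Prop :=
  ∀ P : P2, D P = (if P = Pt i 0 then 1 else 0) + (if P = Pt i 1 then 1 else 0)
    + (if P = Pt j 0 then 1 else 0) + (if P = Pt j 1 then 1 else 0)

end Tangency

section VectorGeometry

open Matrix

/-- A covector `L` vanishing at `p` extends to a basis of covectors whose dual basis
contains `p`. -/
lemma exists_dual_frame {p L : Fin 3 → ℂ} (hp : p ≠ 0) (hL : L ≠ 0) (h : L ⬝ᵥ p = 0) :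
    ∃ T W v n : Fin 3 → ℂ, T ⬝ᵥ p = 0 ∧ W ⬝ᵥ p = 1 ∧ T ⬝ᵥ v = 1 ∧ L ⬝ᵥ v = 0 ∧
      (∀ u : Fin 3 → ℂ, u = (u ⬝ᵥ p) • W + (u ⬝ᵥ v) • T + (u ⬝ᵥ n) • L) ∧
      ∀ x : Fin 3 → ℂ, x = (W ⬝ᵥ x) • p + (T ⬝ᵥ x) • v + (L ⬝ᵥ x) • n := by
  have key : ∀ q : Fin 3 → ℂ, q ≠ 0 → ∃ w : Fin 3 → ℂ, w ⬝ᵥ q = 1 := by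
    intro q hq
    obtain ⟨a, ha⟩ := Function.ne_iff.mp hq
    exact ⟨Pi.single a (q a)⁻¹, by simpa using inv_mul_cancel₀ ha⟩
  obtain ⟨W, hW⟩ := key p hp
  obtain ⟨y, hy⟩ := key L hL
  set T : Fin 3 → ℂ := p ⨯₃ y with hT
  set v : Fin 3 → ℂ := W ⨯₃ L with hv
  set n : Fin 3 → ℂ := T ⨯₃ W with hn
  have hMN : (Matrix.of ![W, T, L]) * (Matrix.of ![p, v, n])ᵀ = 1 := by
    simp only [dotProduct, Fin.sum_univ_three] at hW hy h
    ext i j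
    fin_cases i <;> fin_cases j <;>
      simp [Matrix.mul_apply, Fin.sum_univ_three, hn, hv, hT, cross_apply] <;>
      first
        | ring1
        | linear_combination hW
        | linear_combination h
        | linear_combination (y 0 * L 0 + y 1 * L 1 + y 2 * L 2) * hW + hy
            - (y 0 * W 0 + y 1 * W 1 + y 2 * W 2) * h
  have hNM := mul_eq_one_comm.mp hMN
  have e : ∀ i j, ((Matrix.of ![W, T, L]) * (Matrix.of ![p, v, n])ᵀ) i j
      = (1 : Matrix (Fin 3) (Fin 3) ℂ) i j := fun i j => by rw [hMN]
  have e' : ∀ i j, p i * W j + v i * T j + n i * L j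
      = (1 : Matrix (Fin 3) (Fin 3) ℂ) i j := fun i j => by
    rw [← hNM]; simp [Matrix.mul_apply, Fin.sum_univ_three]
  refine ⟨T, W, v, n, ?_, hW, ?_, ?_, ?_, ?_⟩
  · simpa [Matrix.mul_apply, dotProduct] using e 1 0
  · simpa [Matrix.mul_apply, dotProduct] using e 1 1
  · simpa [Matrix.mul_apply, dotProduct] using e 2 1
  · intro u
    ext j
    have h0 := e' 0 j
    have h1 := e' 1 j
    have h2 := e' 2 j
    have hu : u j = u 0 * (1 : Matrix (Fin 3) (Fin 3) ℂ) 0 j + u 1 * (1 : Matrix (Fin 3) (Fin 3) ℂ) 1 j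
        + u 2 * (1 : Matrix (Fin 3) (Fin 3) ℂ) 2 j := by
      fin_cases j <;> simp [Matrix.one_apply]
    rw [hu, ← h0, ← h1, ← h2]
    simp [dotProduct, Fin.sum_univ_three]
    ring
  · intro u
    ext j
    have h0 := e' j 0
    have h1 := e' j 1
    have h2 := e' j 2
    have hu : u j = u 0 * (1 : Matrix (Fin 3) (Fin 3) ℂ) j 0 + u 1 * (1 : Matrix (Fin 3) (Fin 3) ℂ) j 1
        + u 2 * (1 : Matrix (Fin 3) (Fin 3) ℂ) j 2 := by
      fin_cases j <;> simp [Matrix.one_apply]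
    rw [hu, ← h0, ← h1, ← h2]
    simp [dotProduct, Fin.sum_univ_three]
    ring

lemma dotProduct_mulVec_comm_of_isSymm {S : Matrix (Fin 3) (Fin 3) ℂ} (hS : S.IsSymm)
    (a b : Fin 3 → ℂ) : a ⬝ᵥ S *ᵥ b = b ⬝ᵥ S *ᵥ a := by
  rw [dotProduct_mulVec, ← mulVec_transpose, hS.eq, dotProduct_comm]

/-- A tangent line of a smooth conic meets the conic only at the point of tangency. -/
lemma eq_smul_of_tangent {S : Matrix (Fin 3) (Fin 3) ℂ} (hS : S.IsSymm)
    (hinj : ∀ u, S *ᵥ u = 0 → u = 0) {p L x : Fin 3 → ℂ} {c : ℂ} (hp : p ≠ 0)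
    (hc : S *ᵥ p = c • L) (hLp : L ⬝ᵥ p = 0) (hLx : L ⬝ᵥ x = 0) (hx : x ⬝ᵥ S *ᵥ x = 0) :
    ∃ a : ℂ, x = a • p := by
  have hL : L ≠ 0 := by
    rintro rfl
    exact hp (hinj p (by simpa using hc))
  have hc0 : c ≠ 0 := by
    rintro rfl
    exact hp (hinj p (by simpa using hc))
  obtain ⟨T, W, v, n, hTp, hWp, hTv, hLv, hu, hxx⟩ := exists_dual_frame hp hL hLp
  have hvp : v ⬝ᵥ S *ᵥ p = 0 := by rw [hc, dotProduct_smul, dotProduct_comm, hLv, smul_zero]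
  have hpp : p ⬝ᵥ S *ᵥ p = 0 := by rw [hc, dotProduct_smul, dotProduct_comm, hLp, smul_zero]
  have hpv : p ⬝ᵥ S *ᵥ v = 0 := by rw [dotProduct_mulVec_comm_of_isSymm hS, hvp]
  have hvv : v ⬝ᵥ S *ᵥ v ≠ 0 := by
    intro hvv
    have h1 := hu (S *ᵥ v)
    rw [dotProduct_comm _ p, dotProduct_comm _ v, hpv, hvv] at h1
    set d := (S *ᵥ v) ⬝ᵥ n
    have h2 : S *ᵥ (v - (d / c) • p) = 0 := by
      rw [mulVec_sub, mulVec_smul, hc, h1, smul_smul, div_mul_cancel₀ _ hc0]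
      simp
    have h3 := hinj _ h2
    have h4 : T ⬝ᵥ (v - (d / c) • p) = 0 := by rw [h3, dotProduct_zero]
    rw [dotProduct_sub, dotProduct_smul, hTp, hTv] at h4
    simp at h4
  have h1 := hxx x
  rw [hLx] at h1
  refine ⟨W ⬝ᵥ x, ?_⟩
  set a := W ⬝ᵥ x
  set b := T ⬝ᵥ x
  have hb : b * b * (v ⬝ᵥ S *ᵥ v) = 0 := by
    rw [h1] at hx
    simp only [zero_smul, add_zero, mulVec_add, mulVec_smul, dotProduct_add, add_dotProduct,
      dotProduct_smul, smul_dotProduct, hpp, hpv, hvp, smul_eq_mul, mul_zero, zero_add] at hx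
    linear_combination hx
  have hb0 : b = 0 := by simpa [hvv] using hb
  rw [h1, hb0]
  simp

/-- The equation of a smooth conic tangent to the three coordinate lines, in terms of the
off-diagonal entries of the dual conic. -/
lemma conic_eq_of_dual {S M : Matrix (Fin 3) (Fin 3) ℂ} {p q r : ℂ}
    (hS : IsUnit S.det) (hp : p ≠ 0) (hq : q ≠ 0) (hr : r ≠ 0)
    (hD : M * S⁻¹ * Mᵀ = !![0, r, q; r, 0, p; q, p, 0]) (x : Fin 3 → ℂ) :
    IsUnit M.det ∧ 2 * p * q * r * (x ⬝ᵥ S *ᵥ x) =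
      -(p ^ 2 * (M 0 ⬝ᵥ x) ^ 2 + q ^ 2 * (M 1 ⬝ᵥ x) ^ 2 + r ^ 2 * (M 2 ⬝ᵥ x) ^ 2
        - 2 * p * q * (M 0 ⬝ᵥ x) * (M 1 ⬝ᵥ x) - 2 * p * r * (M 0 ⬝ᵥ x) * (M 2 ⬝ᵥ x)
        - 2 * q * r * (M 1 ⬝ᵥ x) * (M 2 ⬝ᵥ x)) := by
  set D : Matrix (Fin 3) (Fin 3) ℂ := !![0, r, q; r, 0, p; q, p, 0] with hDdef
  have hdet : D.det = 2 * p * q * r := by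
    simp [hDdef, det_fin_three]; ring
  have hDu : D.det ≠ 0 := by rw [hdet]; simp [hp, hq, hr]
  have hM : IsUnit M.det := by
    have h := congrArg det hD
    rw [det_mul, det_mul] at h
    rw [isUnit_iff_ne_zero]
    intro h0
    rw [h0, zero_mul, zero_mul] at h
    exact hDu h.symm
  refine ⟨hM, ?_⟩
  have hMt : IsUnit (Mᵀ).det := by rwa [det_transpose]
  have hinv : D * ((Mᵀ)⁻¹ * S * M⁻¹) = 1 := by
    rw [← hD]
    calc M * S⁻¹ * Mᵀ * ((Mᵀ)⁻¹ * S * M⁻¹) = M * S⁻¹ * (Mᵀ * (Mᵀ)⁻¹) * S * M⁻¹ := by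
          simp only [Matrix.mul_assoc]
      _ = M * (S⁻¹ * S) * M⁻¹ := by
          rw [mul_nonsing_inv _ hMt, Matrix.mul_one]; simp only [Matrix.mul_assoc]
      _ = 1 := by rw [nonsing_inv_mul _ hS, Matrix.mul_one, mul_nonsing_inv _ hM]
  have hadj : D.adjugate = D.det • ((Mᵀ)⁻¹ * S * M⁻¹) := by
    calc D.adjugate = D.adjugate * (D * ((Mᵀ)⁻¹ * S * M⁻¹)) := by rw [hinv, Matrix.mul_one]
      _ = _ := by rw [← Matrix.mul_assoc, adjugate_mul, Matrix.smul_mul, Matrix.one_mul]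
  have hSS : D.det • S = Mᵀ * D.adjugate * M := by
    rw [hadj]
    simp only [Matrix.mul_smul, Matrix.smul_mul]
    congr 1
    calc S = (Mᵀ * (Mᵀ)⁻¹) * S * (M⁻¹ * M) := by
          rw [mul_nonsing_inv _ hMt, nonsing_inv_mul _ hM]; simp
      _ = _ := by simp only [Matrix.mul_assoc]
  have h1 : D.det * (x ⬝ᵥ S *ᵥ x) = (M *ᵥ x) ⬝ᵥ D.adjugate *ᵥ (M *ᵥ x) := by
    calc D.det * (x ⬝ᵥ S *ᵥ x) = x ⬝ᵥ (D.det • S) *ᵥ x := by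
          rw [smul_mulVec, dotProduct_smul, smul_eq_mul]
      _ = _ := by
          rw [hSS, ← mulVec_mulVec, ← mulVec_mulVec, dotProduct_mulVec, vecMul_transpose]
  rw [← hdet, h1, hDdef, adjugate_fin_three_of]
  have hMx : M *ᵥ x = ![M 0 ⬝ᵥ x, M 1 ⬝ᵥ x, M 2 ⬝ᵥ x] := by
    ext i; fin_cases i <;> rfl
  rw [hMx]
  generalize M 0 ⬝ᵥ x = X
  generalize M 1 ⬝ᵥ x = Y
  generalize M 2 ⬝ᵥ x = Z
  simp [dotProduct, mulVec, Fin.sum_univ_three]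
  ring

/-- Two distinct tangent lines of a smooth conic do not meet at a point of tangency. -/
lemma dotProduct_ne_zero_of_tangent {S : Matrix (Fin 3) (Fin 3) ℂ} (hS : S.IsSymm)
    (hinj : ∀ u, S *ᵥ u = 0 → u = 0) {p p' L L' : Fin 3 → ℂ} {c c' : ℂ}
    (hp : p ≠ 0) (hp' : p' ≠ 0) (hc : S *ᵥ p = c • L) (hc' : S *ᵥ p' = c' • L')
    (hLp : L ⬝ᵥ p = 0) (hLp' : L' ⬝ᵥ p' = 0) (hLL' : ∀ a : ℂ, L' ≠ a • L) :
    L' ⬝ᵥ p ≠ 0 := by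
  intro h
  have hc0 : c ≠ 0 := by
    rintro rfl
    exact hp (hinj p (by simpa using hc))
  have hc0' : c' ≠ 0 := by
    rintro rfl
    exact hp' (hinj p' (by simpa using hc'))
  have h1 : p ⬝ᵥ S *ᵥ p' = 0 := by rw [hc', dotProduct_smul, dotProduct_comm, h, smul_zero]
  have h2 : L ⬝ᵥ p' = 0 := by
    rw [dotProduct_mulVec_comm_of_isSymm hS, hc, dotProduct_smul, dotProduct_comm] at h1
    simpa [hc0] using h1
  obtain ⟨a, ha⟩ := eq_smul_of_tangent hS hinj hp hc hLp h2
    (by rw [hc', dotProduct_smul, dotProduct_comm, hLp', smul_zero])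
  apply hLL' (a * c / c')
  have h3 : c' • L' = (a * c) • L := by rw [← hc', ha, mulVec_smul, hc, smul_smul]
  rw [div_eq_inv_mul, ← smul_smul, ← h3, smul_smul, inv_mul_cancel₀ hc0', one_smul]

/-- The equation of a smooth conic tangent to four given lines. -/
lemma conic_eq_of_four_tangents {S : Matrix (Fin 3) (Fin 3) ℂ} (hS : S.IsSymm)
    (hinj : ∀ u, S *ᵥ u = 0 → u = 0) {L P : Fin 4 → Fin 3 → ℂ} (hP : ∀ i, P i ≠ 0)
    (hc : ∀ i, ∃ c : ℂ, S *ᵥ P i = c • L i) (hLP : ∀ i, L i ⬝ᵥ P i = 0)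
    (hL : ∀ i j, i ≠ j → ∀ a : ℂ, L i ≠ a • L j) :
    ∃ p q r : ℂ, p ≠ 0 ∧ q ≠ 0 ∧ r ≠ 0 ∧
      IsUnit (Matrix.of ![L 0, L 1, L 2]).det ∧
      (∀ x : Fin 3 → ℂ, 2 * p * q * r * (x ⬝ᵥ S *ᵥ x) =
        -(p ^ 2 * (L 0 ⬝ᵥ x) ^ 2 + q ^ 2 * (L 1 ⬝ᵥ x) ^ 2 + r ^ 2 * (L 2 ⬝ᵥ x) ^ 2
          - 2 * p * q * (L 0 ⬝ᵥ x) * (L 1 ⬝ᵥ x) - 2 * p * r * (L 0 ⬝ᵥ x) * (L 2 ⬝ᵥ x)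
          - 2 * q * r * (L 1 ⬝ᵥ x) * (L 2 ⬝ᵥ x))) ∧
      ∀ α β γ : ℂ, L 3 = α • L 0 + β • L 1 + γ • L 2 →
        β * γ * p + α * γ * q + α * β * r = 0 := by
  have hdet : IsUnit S.det := by
    rw [isUnit_iff_ne_zero]
    intro h
    obtain ⟨u, hu, hu'⟩ := exists_mulVec_eq_zero_iff.mpr h
    exact hu (hinj u hu')
  choose c hc using hc
  have hc0 : ∀ i, c i ≠ 0 := by
    intro i h
    exact hP i (hinj _ (by rw [hc, h, zero_smul]))
  have hSL : ∀ i, S⁻¹ *ᵥ L i = (c i)⁻¹ • P i := by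
    intro i
    have h : L i = S *ᵥ ((c i)⁻¹ • P i) := by
      rw [mulVec_smul, hc, smul_smul, inv_mul_cancel₀ (hc0 i), one_smul]
    conv_lhs => rw [h]
    rw [mulVec_mulVec, nonsing_inv_mul _ hdet, one_mulVec]
  have hS' : (S⁻¹).IsSymm := by
    rw [Matrix.IsSymm, transpose_nonsing_inv, hS.eq]
  set d : Fin 4 → Fin 4 → ℂ := fun i j => L i ⬝ᵥ S⁻¹ *ᵥ L j with hd
  have hdc : ∀ i j, d i j = d j i := fun i j => dotProduct_mulVec_comm_of_isSymm hS' _ _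
  have hdd : ∀ i, d i i = 0 := by
    intro i
    simp [hd, hSL, hLP]
  have hdn : ∀ i j, i ≠ j → d i j ≠ 0 := by
    intro i j hij
    simp only [hd, hSL, dotProduct_smul, smul_eq_mul]
    exact mul_ne_zero (inv_ne_zero (hc0 j)) (dotProduct_ne_zero_of_tangent hS hinj (hP j) (hP i)
      (hc j) (hc i) (hLP j) (hLP i) (hL i j hij))
  have hentry : ∀ i j, (Matrix.of ![L 0, L 1, L 2] * S⁻¹ * (Matrix.of ![L 0, L 1, L 2])ᵀ) i j
      = d (Fin.castSucc i) (Fin.castSucc j) := by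
    intro i j
    rw [Matrix.mul_assoc]
    fin_cases i <;> fin_cases j <;> rfl
  have hD : Matrix.of ![L 0, L 1, L 2] * S⁻¹ * (Matrix.of ![L 0, L 1, L 2])ᵀ
      = !![0, d 0 1, d 0 2; d 0 1, 0, d 1 2; d 0 2, d 1 2, 0] := by
    ext i j
    rw [hentry]
    fin_cases i <;> fin_cases j <;> simp [hdd, hdc 1 0, hdc 2 0, hdc 2 1]
  have key := conic_eq_of_dual hdet (hdn 1 2 (by decide)) (hdn 0 2 (by decide))
    (hdn 0 1 (by decide)) hD
  refine ⟨d 1 2, d 0 2, d 0 1, hdn 1 2 (by decide), hdn 0 2 (by decide), hdn 0 1 (by decide),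
    (key 0).1, fun x => (key x).2, ?_⟩
  intro α β γ h3
  have h33 := hdd 3
  simp only [hd, h3, mulVec_add, mulVec_smul, dotProduct_add, add_dotProduct, dotProduct_smul,
    smul_dotProduct, smul_eq_mul] at h33
  have a0 := hdd 0
  have a1 := hdd 1
  have a2 := hdd 2
  have b0 := hdc 1 0
  have b1 := hdc 2 0
  have b2 := hdc 2 1
  simp only [hd] at a0 a1 a2 b0 b1 b2 ⊢
  rw [a0, a1, a2, b0, b1, b2] at h33
  linear_combination h33 / 2

/-- The contact conic of two smooth conics with four common tangent lines: the conic passing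
through the eight points of tangency. -/
lemma exists_contact_conic {S : Fin 2 → Matrix (Fin 3) (Fin 3) ℂ} (hS : ∀ k, (S k).IsSymm)
    (hinj : ∀ k u, S k *ᵥ u = 0 → u = 0) {L : Fin 4 → Fin 3 → ℂ}
    {P : Fin 4 → Fin 2 → Fin 3 → ℂ} (hP : ∀ i k, P i k ≠ 0)
    (hc : ∀ i k, ∃ c : ℂ, S k *ᵥ P i k = c • L i) (hLP : ∀ i k, L i ⬝ᵥ P i k = 0)
    (hL : ∀ i j, i ≠ j → ∀ a : ℂ, L i ≠ a • L j)
    (hne : ¬ ∃ a : ℂ, a ≠ 0 ∧ ∀ x, x ⬝ᵥ S 0 *ᵥ x = a * (x ⬝ᵥ S 1 *ᵥ x)) :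
    ∃ (F : MvPolynomial (Fin 3) ℂ) (c K : ℂ), F.IsHomogeneous 2 ∧ c ≠ 0 ∧ K ≠ 0 ∧
      ∀ x : Fin 3 → ℂ, eval x F ^ 2 =
        c * (x ⬝ᵥ S 0 *ᵥ x) * (x ⬝ᵥ S 1 *ᵥ x) + K * ∏ i, L i ⬝ᵥ x := by
  obtain ⟨p, q, r, hp, hq, hr, hM, hf, hr3⟩ := conic_eq_of_four_tangents (hS 0) (hinj 0)
    (fun i => hP i 0) (fun i => hc i 0) (fun i => hLP i 0) hL
  obtain ⟨p', q', r', hp', hq', hr', -, hf', hr3'⟩ := conic_eq_of_four_tangents (hS 1) (hinj 1)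
    (fun i => hP i 1) (fun i => hc i 1) (fun i => hLP i 1) hL
  obtain ⟨α, β, γ, h3⟩ : ∃ α β γ : ℂ, L 3 = α • L 0 + β • L 1 + γ • L 2 := by
    set M := Matrix.of ![L 0, L 1, L 2]
    have h : L 3 = (L 3 ᵥ* M⁻¹) ᵥ* M := by
      rw [vecMul_vecMul, nonsing_inv_mul _ hM, vecMul_one]
    refine ⟨(L 3 ᵥ* M⁻¹) 0, (L 3 ᵥ* M⁻¹) 1, (L 3 ᵥ* M⁻¹) 2, ?_⟩
    conv_lhs => rw [h]
    ext j
    simp [vecMul, dotProduct, Fin.sum_univ_three, M]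
  have e := hr3 α β γ h3
  have e' := hr3' α β γ h3
  have hα : α ≠ 0 := by
    rintro rfl
    have : β * γ = 0 := by simpa [hp] using e
    rcases mul_eq_zero.mp this with rfl | rfl
    · exact hL 3 2 (by decide) γ (by simpa using h3)
    · exact hL 3 1 (by decide) β (by simpa using h3)
  have hβ : β ≠ 0 := by
    rintro rfl
    have : α * γ = 0 := by simpa [hq] using e
    rcases mul_eq_zero.mp this with rfl | rfl
    · exact hL 3 2 (by decide) γ (by simpa using h3)
    · exact hL 3 0 (by decide) α (by simpa using h3)
  have hγ : γ ≠ 0 := by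
    rintro rfl
    have : α * β = 0 := by simpa [hr] using e
    rcases mul_eq_zero.mp this with rfl | rfl
    · exact hL 3 1 (by decide) β (by simpa using h3)
    · exact hL 3 0 (by decide) α (by simpa using h3)
  set a := q * r' - q' * r with ha
  set b := r * p' - r' * p with hb
  set c := p * q' - p' * q with hc'
  have hab : α * a = β * b := by
    apply mul_left_cancel₀ hγ
    rw [ha, hb]
    linear_combination r' * e - r * e'
  have hac : α * a = γ * c := by
    apply mul_left_cancel₀ hβ
    rw [ha, hc']
    linear_combination q * e' - q' * e
  set κ := α * a with hκ
  have hκ0 : κ ≠ 0 := by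
    intro h0
    have ha0 : a = 0 := by simpa [hκ, hα] using h0
    have hb0 : b = 0 := by simpa [hab, hβ] using h0
    have hc0 : c = 0 := by simpa [hac, hγ] using h0
    apply hne
    refine ⟨p' / p, div_ne_zero hp' hp, fun x => ?_⟩
    have hqq : q' = p' / p * q := by
      field_simp; linear_combination hc0 - hc'
    have hrr : r' = p' / p * r := by
      field_simp; linear_combination hb - hb0
    have h1 := hf x
    have h2 := hf' x
    have hpp : p' = p' / p * p := by field_simp
    set t := p' / p with ht
    have ht0 : t ≠ 0 := div_ne_zero hp' hp
    rw [hpp, hqq, hrr] at h2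
    have h3 : 2 * p * q * r * t ^ 2 ≠ 0 := by simp [hp, hq, hr, ht0]
    apply mul_left_cancel₀ h3
    linear_combination t ^ 2 * h1 - h2
  set l : Fin 4 → MvPolynomial (Fin 3) ℂ := fun i => ∑ m, C (L i m) * X m with hl
  have hlh : ∀ i, (l i).IsHomogeneous 1 := fun i =>
    IsHomogeneous.sum _ _ _ fun m _ => by simpa using (isHomogeneous_C _ _).mul (isHomogeneous_X ℂ m)
  have hle : ∀ i x, eval x (l i) = L i ⬝ᵥ x := fun i x => by simp [hl, dotProduct]
  have hmon : ∀ (z : ℂ) (i j : Fin 4), (C z * (l i * l j)).IsHomogeneous 2 := fun z i j => by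
    simpa using (isHomogeneous_C _ z).mul ((hlh i).mul (hlh j))
  refine ⟨C (p * p') * (l 0 * l 0) + C (q * q') * (l 1 * l 1) + C (r * r') * (l 2 * l 2)
    + C (-(p * q' + p' * q)) * (l 0 * l 1) + C (-(p * r' + p' * r)) * (l 0 * l 2)
    + C (-(q * r' + q' * r)) * (l 1 * l 2), (2 * p * q * r) * (2 * p' * q' * r'),
    -4 * κ ^ 2 / (α * β * γ), ?_, ?_, ?_, ?_⟩
  · exact ((((((hmon _ _ _).add (hmon _ _ _)).add (hmon _ _ _)).add (hmon _ _ _)).add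
      (hmon _ _ _)).add (hmon _ _ _))
  · simp [hp, hq, hr, hp', hq', hr']
  · simp [hκ0, hα, hβ, hγ]
  · intro x
    have h1 := hf x
    have h2 := hf' x
    have h3x : L 3 ⬝ᵥ x = α * (L 0 ⬝ᵥ x) + β * (L 1 ⬝ᵥ x) + γ * (L 2 ⬝ᵥ x) := by
      rw [h3]; simp [add_dotProduct, smul_dotProduct]
    rw [Fin.prod_univ_four, h3x]
    simp only [map_add, map_mul, eval_C, hle]
    have hbc : κ ^ 2 / (α * β * γ) * α = b * c := by
      field_simp; linear_combination β * b * hac + κ * hab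
    have hac' : κ ^ 2 / (α * β * γ) * β = a * c := by
      field_simp; linear_combination κ * hac
    have hab' : κ ^ 2 / (α * β * γ) * γ = a * b := by
      field_simp; linear_combination κ * hab
    set w := κ ^ 2 / (α * β * γ) with hw
    have hw4 : -4 * κ ^ 2 / (α * β * γ) = -4 * w := by rw [hw]; ring
    rw [hw4]
    have h12 : (2 * p * q * r) * (2 * p' * q' * r') * (x ⬝ᵥ S 0 *ᵥ x) * (x ⬝ᵥ S 1 *ᵥ x)
      = (2 * p * q * r * (x ⬝ᵥ S 0 *ᵥ x)) * (2 * p' * q' * r' * (x ⬝ᵥ S 1 *ᵥ x)) := by ring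
    rw [h12, h1, h2]
    generalize L 0 ⬝ᵥ x = X0
    generalize L 1 ⬝ᵥ x = X1
    generalize L 2 ⬝ᵥ x = X2
    have hbc2 : w * α = (r * p' - r' * p) * (p * q' - p' * q) := hbc
    have hac2 : w * β = (q * r' - q' * r) * (p * q' - p' * q) := hac'
    have hab2 : w * γ = (q * r' - q' * r) * (r * p' - r' * p) := hab'
    linear_combination 4 * X0 * X1 * X2 * (X0 * hbc2 + X1 * hac2 + X2 * hab2)

end VectorGeometry

section LocalStructure

open Matrix

/-- The linear form with coefficient vector `L`. -/
def linForm (L : Fin 3 → ℂ) : MvPolynomial (Fin 3) ℂ := ∑ m, C (L m) * X m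

lemma linForm_isHomogeneous (L : Fin 3 → ℂ) : (linForm L).IsHomogeneous 1 :=
  IsHomogeneous.sum _ _ _ fun m _ => by
    simpa using (isHomogeneous_C _ _).mul (isHomogeneous_X ℂ m)

@[simp]
lemma eval_linForm (L x : Fin 3 → ℂ) : eval x (linForm L) = L ⬝ᵥ x := by
  simp [linForm, dotProduct]

@[simp]
lemma pderiv_linForm (L : Fin 3 → ℂ) (m : Fin 3) : pderiv m (linForm L) = C (L m) := by
  simp [linForm, pderiv_X, Pi.single_apply]

lemma exists_eq_C_of_isHomogeneous_zero {G : MvPolynomial (Fin 3) ℂ} (hG : G.IsHomogeneous 0) :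
    ∃ z : ℂ, G = C z :=
  ⟨_, totalDegree_eq_zero_iff_eq_C.mp ((totalDegree_zero_iff_isHomogeneous (p := G)).2 hG)⟩

lemma exists_eq_linForm {G : MvPolynomial (Fin 3) ℂ} (hG : G.IsHomogeneous 1) :
    ∃ L, G = linForm L := by
  choose L hL using fun m => exists_eq_C_of_isHomogeneous_zero (hG.pderiv (i := m))
  refine ⟨L, ?_⟩
  have h := hG.sum_X_mul_pderiv
  simp only [hL, one_smul] at h
  rw [← h, linForm]
  exact Finset.sum_congr rfl fun m _ => mul_comm _ _

/-- The symmetric matrix of a quadratic form. -/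
lemma exists_symm_matrix {G : MvPolynomial (Fin 3) ℂ} (hG : G.IsHomogeneous 2) :
    ∃ S : Matrix (Fin 3) (Fin 3) ℂ, S.IsSymm ∧ (∀ x, eval x G = x ⬝ᵥ S *ᵥ x) ∧
      ∀ x m, eval x (pderiv m G) = 2 * (S *ᵥ x) m := by
  choose L hL using fun m => exists_eq_linForm (hG.pderiv (i := m))
  have h2 : ∀ x m, eval x (pderiv m G) = 2 * ((Matrix.of fun i j => L i j / 2) *ᵥ x) m := by
    intro x m
    rw [hL, eval_linForm]
    simp only [mulVec, dotProduct, Finset.mul_sum, of_apply]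
    exact Finset.sum_congr rfl fun k _ => by ring
  refine ⟨Matrix.of fun i j => L i j / 2, ?_, ?_, h2⟩
  · ext i j
    have h := congrArg (eval (Pi.single j 1)) (congrArg (pderiv i) hG.sum_X_mul_pderiv)
    simp only [hL, map_sum, Derivation.leibniz, pderiv_X, pderiv_linForm, map_nsmul] at h
    simp [Pi.single_apply, Finset.sum_add_distrib, dotProduct, apply_ite (eval _)] at h
    simp only [transpose_apply, of_apply]
    linear_combination h / 2
  · intro x
    have h := congrArg (eval x) hG.sum_X_mul_pderiv
    simp only [map_sum, map_mul, eval_X, h2, nsmul_eq_mul, Nat.cast_ofNat, map_ofNat] at h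
    apply mul_left_cancel₀ (two_ne_zero (α := ℂ))
    rw [← h]
    simp only [dotProduct, Finset.mul_sum]
    exact Finset.sum_congr rfl fun k _ => by ring

/-- A homogeneous polynomial vanishing at `p` is a combination of two linear forms spanning
the linear forms vanishing at `p`. -/
lemma exists_division {p v n : Fin 3 → ℂ} {t l w : MvPolynomial (Fin 3) ℂ}
    (hw : w.IsHomogeneous 1)
    (htp : eval p t = 0) (hlp : eval p l = 0) (hwp : eval p w = 1)
    (hX : ∀ m, X m = C (p m) * w + C (v m) * t + C (n m) * l) (d : ℕ)
    {G : MvPolynomial (Fin 3) ℂ} (hG : G.IsHomogeneous (d + 1)) (hGp : eval p G = 0) :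
    ∃ A B : MvPolynomial (Fin 3) ℂ, A.IsHomogeneous d ∧ B.IsHomogeneous d ∧
      G = t * A + l * B := by
  have euler : ∀ (d : ℕ) (G : MvPolynomial (Fin 3) ℂ), G.IsHomogeneous (d + 1) →
      G = C (((d : ℂ) + 1)⁻¹) * ∑ m, X m * pderiv m G := by
    intro d G hG
    rw [hG.sum_X_mul_pderiv, nsmul_eq_mul, ← map_natCast (C : ℂ →+* MvPolynomial (Fin 3) ℂ),
      ← mul_assoc, ← C_mul, Nat.cast_add, Nat.cast_one, inv_mul_cancel₀, C_1, one_mul]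
    exact_mod_cast Nat.succ_ne_zero d
  have key : ∀ (d : ℕ) (G : MvPolynomial (Fin 3) ℂ), G.IsHomogeneous d → ∀ m,
      ∃ (A B : MvPolynomial (Fin 3) ℂ) (z : ℂ), A.IsHomogeneous d ∧ B.IsHomogeneous d ∧
        X m * G = t * A + l * B + C z * w ^ (d + 1) := by
    intro d
    induction d with
    | zero =>
      intro G hG m
      obtain ⟨z, rfl⟩ := exists_eq_C_of_isHomogeneous_zero hG
      refine ⟨C (v m * z), C (n m * z), p m * z, isHomogeneous_C _ _, isHomogeneous_C _ _, ?_⟩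
      rw [hX]
      simp only [C_mul]
      ring
    | succ d ih =>
      intro G hG m
      choose A B z hA hB h using fun k => ih (pderiv k G) (by simpa using hG.pderiv (i := k)) k
      set i := ((d : ℂ) + 1)⁻¹
      refine ⟨C i * (X m * ∑ k, A k + C (v m * ∑ k, z k) * w ^ (d + 1)),
        C i * (X m * ∑ k, B k + C (n m * ∑ k, z k) * w ^ (d + 1)), i * (p m * ∑ k, z k),
        ?_, ?_, ?_⟩
      · have h1 : (X m * ∑ k, A k).IsHomogeneous (d + 1) := by
          simpa [add_comm] using (isHomogeneous_X ℂ m).mul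
            (IsHomogeneous.sum Finset.univ _ d fun k _ => hA k)
        have h2 : (C (v m * ∑ k, z k) * w ^ (d + 1)).IsHomogeneous (d + 1) := by
          simpa using (isHomogeneous_C _ (v m * ∑ k, z k)).mul (hw.pow (d + 1))
        simpa using (isHomogeneous_C _ i).mul (h1.add h2)
      · have h1 : (X m * ∑ k, B k).IsHomogeneous (d + 1) := by
          simpa [add_comm] using (isHomogeneous_X ℂ m).mul
            (IsHomogeneous.sum Finset.univ _ d fun k _ => hB k)
        have h2 : (C (n m * ∑ k, z k) * w ^ (d + 1)).IsHomogeneous (d + 1) := by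
          simpa using (isHomogeneous_C _ (n m * ∑ k, z k)).mul (hw.pow (d + 1))
        simpa using (isHomogeneous_C _ i).mul (h1.add h2)
      · conv_lhs => rw [euler d G hG]
        simp only [h, Finset.sum_add_distrib, ← Finset.mul_sum, ← Finset.sum_mul, ← map_sum]
        simp only [C_mul]
        linear_combination (C i * C (∑ k, z k) * w ^ (d + 1)) * hX m
  choose A B z hA hB h using fun k => key d (pderiv k G) (by simpa using hG.pderiv (i := k)) k
  set i := ((d : ℂ) + 1)⁻¹
  have hG' := euler d G hG
  simp only [h, Finset.sum_add_distrib, ← Finset.mul_sum, ← Finset.sum_mul, ← map_sum] at hG'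
  have hz : C i * C (∑ k, z k) = (0 : MvPolynomial (Fin 3) ℂ) := by
    have h0 := congrArg (eval p) hG'
    rw [hGp] at h0
    simp only [map_add, map_mul, map_pow, htp, hlp, hwp, eval_C] at h0
    rw [← C_mul, ← C_0]
    congr 1
    linear_combination -h0
  refine ⟨C i * ∑ k, A k, C i * ∑ k, B k, ?_, ?_, ?_⟩
  · simpa using (isHomogeneous_C _ i).mul (IsHomogeneous.sum _ _ _ fun k _ => hA k)
  · simpa using (isHomogeneous_C _ i).mul (IsHomogeneous.sum _ _ _ fun k _ => hB k)
  · linear_combination hG' + w ^ (d + 1) * hz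

lemma exists_covector_vanishing {p : Fin 3 → ℂ} (hp : p ≠ 0) :
    ∃ L : Fin 3 → ℂ, L ≠ 0 ∧ L ⬝ᵥ p = 0 := by
  obtain ⟨a, ha⟩ := Function.ne_iff.mp hp
  obtain ⟨b, hb⟩ := exists_ne a
  refine ⟨Pi.single a (p b) - Pi.single b (p a), ?_, ?_⟩
  · intro h
    have := congrFun h b
    simp [hb] at this
    exact ha this
  · simp [sub_dotProduct, mul_comm]

lemma mem_pointIdeal {P : P2} {d : ℕ} {G : MvPolynomial (Fin 3) ℂ} (hG : G.IsHomogeneous d)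
    (hGP : pev G P = 0) : G ∈ pointIdeal P := by
  cases d with
  | zero =>
    obtain ⟨z, rfl⟩ := exists_eq_C_of_isHomogeneous_zero hG
    simp only [pev, eval_C] at hGP
    simp [hGP]
  | succ d =>
    have hp := P.rep_nonzero
    obtain ⟨L, hL, hLp⟩ := exists_covector_vanishing hp
    obtain ⟨T, W, v, n, hTp, hWp, -, -, -, hx⟩ := exists_dual_frame hp hL hLp
    obtain ⟨A, B, -, -, rfl⟩ := exists_division (p := P.rep) (v := v) (n := n)
      (t := linForm T) (l := linForm L) (linForm_isHomogeneous W) (by simpa) (by simpa) (by simpa)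
      (fun m => MvPolynomial.funext fun x => by
        have h := congrFun (hx x) m
        simp only [Pi.add_apply, Pi.smul_apply, smul_eq_mul] at h
        simp only [eval_X, map_add, map_mul, eval_C, eval_linForm]
        linear_combination h) d hG hGP
    exact Ideal.add_mem _
      (Ideal.mul_mem_right _ _ (Ideal.subset_span ⟨linForm_isHomogeneous T, by simpa [pev]⟩))
      (Ideal.mul_mem_right _ _ (Ideal.subset_span ⟨linForm_isHomogeneous L, by simpa [pev]⟩))

lemma pev_eq_zero_of_ordGE {f G : MvPolynomial (Fin 3) ℂ} {P : P2} {m : ℕ} (hf : pev f P = 0)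
    (h : OrdGE f P G (m + 1)) : pev G P = 0 := by
  obtain ⟨H, e, -, hH, hmem⟩ := h
  have hle : Ideal.span {f} ⊔ pointIdeal P ^ (m + 1) ≤ RingHom.ker (eval P.rep) := by
    refine sup_le ?_ ((Ideal.pow_le_self (Nat.succ_ne_zero m)).trans ?_)
    · rw [Ideal.span_le, Set.singleton_subset_iff]
      exact hf
    · exact Ideal.span_le.mpr fun l hl => hl.2
  have h0 := hle hmem
  rw [RingHom.mem_ker, map_mul] at h0
  exact (mul_eq_zero.mp h0).resolve_left hH

lemma pev_ne_zero_of_ordEq_zero {f G : MvPolynomial (Fin 3) ℂ} {P : P2} {d : ℕ}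
    (hG : G.IsHomogeneous d) (h : OrdEq f P G 0) : pev G P ≠ 0 := fun h0 =>
  h.2 ⟨1, 0, isHomogeneous_one _ _, by simp [pev], Ideal.mem_sup_right (by
    simpa using mem_pointIdeal hG h0)⟩

/-- At a point of tangency, a form vanishing there to first order along the conic `f` differs
from the contact conic `F` by a unit. -/
lemma exists_unit_ratio {f f' F G : MvPolynomial (Fin 3) ℂ} {P : P2}
    {S : Matrix (Fin 3) (Fin 3) ℂ} {L : Fin 3 → ℂ} {c c₀ : ℂ} {d : ℕ}
    (hf : f.IsHomogeneous 2) (hf' : f'.IsHomogeneous 2) (hF : F.IsHomogeneous 2)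
    (hG : G.IsHomogeneous d) (hS : S.IsSymm) (hinj : ∀ u, S *ᵥ u = 0 → u = 0)
    (hSf : ∀ x, eval x f = x ⬝ᵥ S *ᵥ x) (hSd : ∀ x m, eval x (pderiv m f) = 2 * (S *ᵥ x) m)
    (hc : S *ᵥ P.rep = c • L) (hLP : L ⬝ᵥ P.rep = 0) (hf'P : pev f' P ≠ 0) (hc₀ : c₀ ≠ 0)
    (hFL : ∀ x, L ⬝ᵥ x = 0 → eval x F ^ 2 = c₀ * eval x f * eval x f')
    (hord : OrdEq (f * f') P G 1) :
    ∃ (u h : MvPolynomial (Fin 3) ℂ) (e e' : ℕ), u.IsHomogeneous e ∧ h.IsHomogeneous e' ∧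
      e + 2 = e' + d ∧ pev u P ≠ 0 ∧ pev h P ≠ 0 ∧
      ∀ x : P2, pev f x = 0 → pev u x * pev F x = pev h x * pev G x := by
  have hp := P.rep_nonzero
  set p := P.rep with hpdef
  have hL : L ≠ 0 := by
    rintro rfl
    exact hp (hinj p (by simpa using hc))
  have hc0 : c ≠ 0 := by
    rintro rfl
    exact hp (hinj p (by simpa using hc))
  have hfp : eval p f = 0 := by
    rw [hSf, hc, dotProduct_smul, dotProduct_comm, hLP, smul_zero]
  have hGp : eval p G = 0 := pev_eq_zero_of_ordGE (by simp [pev, ← hpdef, hfp]) hord.1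
  have hFp : eval p F = 0 := by
    have := hFL p hLP
    rw [hfp] at this
    simpa using this
  obtain ⟨T, W, v, n, hTp, hWp, hTv, hLv, hu, hx⟩ := exists_dual_frame hp hL hLP
  have hX : ∀ m, X m = C (p m) * linForm W + C (v m) * linForm T + C (n m) * linForm L :=
    fun m => MvPolynomial.funext fun x => by
      have h := congrFun (hx x) m
      simp only [Pi.add_apply, Pi.smul_apply, smul_eq_mul] at h
      simp only [eval_X, map_add, map_mul, eval_C, eval_linForm]
      linear_combination h
  have hdiv := fun (d : ℕ) (G : MvPolynomial (Fin 3) ℂ) (hG : G.IsHomogeneous (d + 1))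
    (hGp : eval p G = 0) => exists_division (p := p) (v := v) (n := n)
      (t := linForm T) (l := linForm L) (linForm_isHomogeneous W) (by simpa) (by simpa)
      (by simpa) hX d hG hGp
  have hTI : linForm T ∈ pointIdeal P :=
    mem_pointIdeal (linForm_isHomogeneous T) (by simpa [pev])
  obtain ⟨A₀, B₀, hA₀, hB₀, hf0⟩ := hdiv 1 f hf hfp
  obtain ⟨A, B, hA, hB, hF0⟩ := hdiv 1 F hF hFp
  have hgrad : ∀ m, T m * eval p A₀ + L m * eval p B₀ = 2 * (c * L m) := by
    intro m
    have h := hSd p m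
    rw [hc, hf0] at h
    simp only [map_add, Derivation.leibniz, pderiv_linForm, smul_eq_mul, map_mul, eval_linForm,
      hTp, hLP, eval_C, Pi.smul_apply] at h
    linear_combination h
  have hA₀p : eval p A₀ = 0 := by
    have h : (T ⬝ᵥ v) * eval p A₀ + (L ⬝ᵥ v) * eval p B₀ = 2 * (c * (L ⬝ᵥ v)) := by
      simp only [dotProduct, Fin.sum_univ_three]
      linear_combination v 0 * hgrad 0 + v 1 * hgrad 1 + v 2 * hgrad 2
    simpa [hTv, hLv] using h
  have hB₀p : eval p B₀ ≠ 0 := by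
    intro h
    apply hL
    ext m
    have := hgrad m
    simpa [hA₀p, h, hc0] using this
  have hAp : eval p A ≠ 0 := by
    intro hAp
    have hvv : v ⬝ᵥ S *ᵥ v ≠ 0 := by
      intro h
      obtain ⟨a, ha⟩ := eq_smul_of_tangent hS hinj hp hc hLP hLv h
      rw [ha, dotProduct_smul, hTp] at hTv
      simp at hTv
    obtain ⟨a, rfl⟩ := exists_eq_linForm hA
    rw [eval_linForm] at hAp
    obtain ⟨S', hS', hSf', -⟩ := exists_symm_matrix hf'
    have hpv : p ⬝ᵥ S *ᵥ v = 0 := by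
      rw [dotProduct_mulVec_comm_of_isSymm hS, hc, dotProduct_smul, dotProduct_comm, hLv, smul_zero]
    have hvp : v ⬝ᵥ S *ᵥ p = 0 := by rw [dotProduct_mulVec_comm_of_isSymm hS, hpv]
    have hpp : p ⬝ᵥ S *ᵥ p = 0 := by rw [← hSf, hfp]
    have line : ∀ s : ℂ, c₀ * (v ⬝ᵥ S *ᵥ v) * eval (s • p + v) f' = (a ⬝ᵥ v) ^ 2 := by
      intro s
      have h := hFL (s • p + v) (by rw [dotProduct_add, dotProduct_smul, hLP, hLv]; simp)
      rw [hF0, hSf (s • p + v)] at h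
      simp only [map_add, map_mul, eval_linForm, dotProduct_add, dotProduct_smul, hTp, hTv, hLP,
        hLv, hAp, mulVec_add, mulVec_smul, add_dotProduct, smul_dotProduct, hpv, hvp, hpp,
        smul_eq_mul] at h
      linear_combination -h
    have hconst : ∀ s : ℂ, eval (s • p + v) f' = eval ((0 : ℂ) • p + v) f' := fun s =>
      mul_left_cancel₀ (mul_ne_zero hc₀ hvv) ((line s).trans (line 0).symm)
    have h1 := hconst 1
    have h2 := hconst (-1)
    simp only [hSf', mulVec_add, mulVec_smul, dotProduct_add, add_dotProduct, dotProduct_smul,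
      smul_dotProduct, smul_eq_mul] at h1 h2
    apply hf'P
    rw [pev, ← hpdef, hSf']
    linear_combination (h1 + h2) / 2
  cases d with
  | zero =>
    obtain ⟨z, rfl⟩ := exists_eq_C_of_isHomogeneous_zero hG
    simp only [eval_C] at hGp
    exact absurd ⟨1, 0, isHomogeneous_one _ _, by simp [pev], by simp [hGp]⟩ hord.2
  | succ d =>
    obtain ⟨A', B', hA', hB', hG0⟩ := hdiv d G hG hGp
    have hA'p : eval p A' ≠ 0 := by
      intro hA'p
      apply hord.2
      refine ⟨B₀ * f', 1 + 2, hB₀.mul hf', ?_, ?_⟩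
      · rw [pev, map_mul]
        exact mul_ne_zero hB₀p hf'P
      · have h : B₀ * f' * G = B' * (f * f') + f' * (linForm T * (A' * B₀ - A₀ * B')) := by
          rw [hG0, hf0]; ring
        rw [h]
        refine Ideal.add_mem _ (Ideal.mem_sup_left (Ideal.mul_mem_left _ _
          (Ideal.mem_span_singleton_self _))) (Ideal.mem_sup_right (Ideal.mul_mem_left _ _ ?_))
        rw [pow_two]
        refine Ideal.mul_mem_mul hTI (mem_pointIdeal (d := d + 1) ((hA'.mul hB₀).sub ?_) ?_)
        · rw [add_comm]; exact hA₀.mul hB'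
        · simp [pev, ← hpdef, hA'p, hA₀p]
    refine ⟨A' * B₀ - A₀ * B', A * B₀ - A₀ * B, d + 1, 1 + 1, (hA'.mul hB₀).sub ?_,
      (hA.mul hB₀).sub (hA₀.mul hB), by omega, ?_, ?_, ?_⟩
    · rw [add_comm]; exact hA₀.mul hB'
    · simp [pev, ← hpdef, hA₀p, hA'p, hB₀p]
    · simp [pev, ← hpdef, hA₀p, hAp, hB₀p]
    · intro x hx
      simp only [pev] at hx ⊢
      rw [hF0, hG0]
      rw [hf0] at hx
      simp only [map_add, map_mul, map_sub] at hx ⊢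
      linear_combination (eval x.rep A' * eval x.rep B - eval x.rep A * eval x.rep B') * hx

end LocalStructure

section BitangentGeometry

open Matrix

lemma p2_eq_of_rep_eq_smul {x y : P2} {a : ℂ} (h : x.rep = a • y.rep) : x = y := by
  rw [← x.mk_rep, ← y.mk_rep, Projectivization.mk_eq_mk_iff']
  exact ⟨a, h.symm⟩

lemma exists_covectors {ι : Type*} {l : ι → MvPolynomial (Fin 3) ℂ}
    (hl : ∀ i, (l i).IsHomogeneous 1) (hl0 : ∀ i, l i ≠ 0)
    (hdist : ∀ i j, i ≠ j → zeroLocus (l i) ≠ zeroLocus (l j)) :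
    ∃ L : ι → Fin 3 → ℂ, (∀ i, l i = linForm (L i)) ∧
      ∀ i j, i ≠ j → ∀ a : ℂ, L i ≠ a • L j := by
  choose L hL using fun i => exists_eq_linForm (hl i)
  refine ⟨L, hL, fun i j hij a ha => hdist i j hij ?_⟩
  have ha0 : a ≠ 0 := by
    rintro rfl
    refine hl0 i ?_
    rw [hL, ha, zero_smul]
    simp [linForm]
  ext x
  simp [_root_.zeroLocus, pev, hL, ha, ha0]

/-- Each component of an arrangement of smooth conics is given by a nondegenerate symmetric
matrix. -/
lemma exists_conic_matrices {n : ℕ} (A : ConicLineArrangement n) (hdeg : ∀ i, A.deg i = 2) :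
    ∃ S : Fin n → Matrix (Fin 3) (Fin 3) ℂ, (∀ k, (S k).IsSymm) ∧
      (∀ k u, S k *ᵥ u = 0 → u = 0) ∧ (∀ k x, eval x (A.f k) = x ⬝ᵥ S k *ᵥ x) ∧
      ∀ k x m, eval x (pderiv m (A.f k)) = 2 * (S k *ᵥ x) m := by
  choose S hS hSf hSd using fun k => exists_symm_matrix (hdeg k ▸ A.homog k)
  refine ⟨S, hS, fun k u hu => ?_, hSf, hSd⟩
  by_contra hu0
  obtain ⟨a, ha⟩ := Projectivization.exists_smul_eq_mk_rep ℂ u hu0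
  have hx : S k *ᵥ (Projectivization.mk ℂ u hu0).rep = 0 := by
    rw [← ha, Units.smul_def, mulVec_smul, hu, smul_zero]
  obtain ⟨m, hm⟩ := A.smooth k (Projectivization.mk ℂ u hu0) (by
    rw [pev, hSf, hx, dotProduct_zero])
  exact hm (by rw [pev, hSd, hx]; simp)

/-- The eight tangency points of the bitangents of two conics are cut out transversally on the
conics by a further conic `F = 0`, whose square is a multiple of the product of the bitangents
on the two conics. -/
lemma exists_conic_through_tangency_points (A : ConicLineArrangement 2) (hdeg : ∀ i, A.deg i = 2)
    {l : Fin 4 → MvPolynomial (Fin 3) ℂ} (hlhom : ∀ i, (l i).IsHomogeneous 1)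
    (hlne : ∀ i, l i ≠ 0) (hldist : ∀ i j, i ≠ j → zeroLocus (l i) ≠ zeroLocus (l j))
    {Pt : Fin 4 → Fin 2 → P2} (htan : ∀ i k, IsTangentLineAt (l i) (A.f k) (Pt i k)) :
    (∀ i k k', k ≠ k' → pev (A.f k') (Pt i k) ≠ 0) ∧
    (∀ i j k, i ≠ j → pev (l j) (Pt i k) ≠ 0) ∧
    (∀ i k x, pev (l i) x = 0 → pev (A.f k) x = 0 → x = Pt i k) ∧
    ∃ (F : MvPolynomial (Fin 3) ℂ) (K : ℂ), F.IsHomogeneous 2 ∧ K ≠ 0 ∧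
      (∀ x ∈ A.plane, pev F x ^ 2 = K * ∏ i, pev (l i) x) ∧
      ∀ i k G d, G.IsHomogeneous d → OrdEq (A.f 0 * A.f 1) (Pt i k) G 1 →
        ∃ (u h : MvPolynomial (Fin 3) ℂ) (e e' : ℕ), u.IsHomogeneous e ∧ h.IsHomogeneous e' ∧
          e + 2 = e' + d ∧ pev u (Pt i k) ≠ 0 ∧ pev h (Pt i k) ≠ 0 ∧
          ∀ x, pev (A.f k) x = 0 → pev u x * pev F x = pev h x * pev G x := by
  obtain ⟨L, hl, hL⟩ := exists_covectors hlhom hlne hldist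
  obtain ⟨S, hS, hinj, hSf, hSd⟩ := exists_conic_matrices A hdeg
  have hLP (i k) : L i ⬝ᵥ (Pt i k).rep = 0 := by
    have := (htan i k).1
    rwa [pev, hl, eval_linForm] at this
  have hc (i k) : ∃ c : ℂ, S k *ᵥ (Pt i k).rep = c • L i := by
    obtain ⟨c, hc⟩ := (htan i k).2.2
    refine ⟨c / 2, funext fun m => ?_⟩
    have := hc m
    rw [pev, pev, hSd, hl, pderiv_linForm, eval_C] at this
    rw [Pi.smul_apply, smul_eq_mul]
    linear_combination this / 2
  have hP (i k) : (Pt i k).rep ≠ 0 := (Pt i k).rep_nonzero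
  have huniq (i k) (x : P2) (hx : L i ⬝ᵥ x.rep = 0) (hfx : pev (A.f k) x = 0) : x = Pt i k := by
    obtain ⟨c, hc⟩ := hc i k
    obtain ⟨a, ha⟩ := eq_smul_of_tangent (hS k) (hinj k) (hP i k) hc (hLP i k) hx
      (by rw [← hSf]; exact hfx)
    exact p2_eq_of_rep_eq_smul ha
  have hother (i k k') (hk : k ≠ k') : pev (A.f k') (Pt i k) ≠ 0 := by
    intro h0
    have heq := huniq i k' (Pt i k) (hLP i k) h0
    obtain ⟨c, hc1⟩ := hc i k
    obtain ⟨c', hc2⟩ := hc i k'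
    have hc0 : c ≠ 0 := by
      rintro rfl
      exact hP i k (hinj k _ (by rw [hc1, zero_smul]))
    refine (A.nodes k k' hk (Pt i k) ⟨(htan i k).2.1, h0⟩).2 ⟨c' / c, fun m => ?_⟩
    rw [pev, pev, hSd, hSd, hc1, heq, hc2]
    simp only [Pi.smul_apply, smul_eq_mul]
    field_simp
  refine ⟨hother, fun i j k hij => ?_, fun i k x hx => huniq i k x ?_, ?_⟩
  · rw [pev, hl, eval_linForm]
    obtain ⟨c, hc1⟩ := hc i k
    obtain ⟨c', hc2⟩ := hc j k
    exact dotProduct_ne_zero_of_tangent (hS k) (hinj k) (hP i k) (hP j k) hc1 hc2 (hLP i k)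
      (hLP j k) (hL j i hij.symm)
  · rwa [pev, hl, eval_linForm] at hx
  have hne : ¬∃ a, a ≠ 0 ∧ ∀ x, x ⬝ᵥ S 0 *ᵥ x = a * (x ⬝ᵥ S 1 *ᵥ x) := by
    rintro ⟨a, ha, h⟩
    refine A.distinct 0 1 (by decide) ?_
    ext x
    simp [_root_.zeroLocus, pev, hSf, h, ha]
  obtain ⟨F, c, K, hF, hc0, hK, hFK⟩ := exists_contact_conic hS hinj hP hc hLP hL hne
  refine ⟨F, K, hF, hK, fun x hx => ?_, fun i k G d hG hord => ?_⟩
  · have hff : (x.rep ⬝ᵥ S 0 *ᵥ x.rep) * (x.rep ⬝ᵥ S 1 *ᵥ x.rep) = 0 := by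
      rw [← hSf, ← hSf]
      obtain ⟨k, hk⟩ := Set.mem_iUnion.1 hx
      have hk : eval x.rep (A.f k) = 0 := hk
      fin_cases k
      · exact mul_eq_zero_of_left hk _
      · exact mul_eq_zero_of_right _ hk
    simp only [pev, hl, eval_linForm]
    rw [hFK, mul_assoc, hff]
    ring
  · obtain ⟨c', hc'⟩ := hc i k
    have hFL (x) (hx : L i ⬝ᵥ x = 0) :
        eval x F ^ 2 = c * eval x (A.f 0) * eval x (A.f 1) := by
      rw [hFK, Finset.prod_eq_zero (Finset.mem_univ i) hx, hSf, hSf, mul_zero, add_zero]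
    have hA (k) : (A.f k).IsHomogeneous 2 := by
      have := A.homog k
      rwa [hdeg k] at this
    fin_cases k
    · exact exists_unit_ratio (hA 0) (hA 1) hF hG (hS 0) (hinj 0) (hSf 0) (hSd 0) hc' (hLP i 0)
        (hother i 0 1 (by decide)) hc0 hFL hord
    · exact exists_unit_ratio (hA 1) (hA 0) hF hG (hS 1) (hinj 1) (hSf 1) (hSd 1) hc' (hLP i 1)
        (hother i 1 0 (by decide)) hc0 (fun x hx => (hFL x hx).trans (mul_right_comm _ _ _))
        (by rw [mul_comm]; exact hord)

end BitangentGeometry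

section QuotientSection

lemma pairwise_ne_of_insert_eq_univ {i j k m : Fin 4}
    (h : ({i, j, k, m} : Finset (Fin 4)) = Finset.univ) :
    i ≠ j ∧ i ≠ k ∧ i ≠ m ∧ j ≠ k ∧ j ≠ m ∧ k ≠ m := by
  decide +revert

lemma pev_mul (p q : MvPolynomial (Fin 3) ℂ) (x : P2) : pev (p * q) x = pev p x * pev q x :=
  map_mul _ _ _

lemma pev_C (a : ℂ) (x : P2) : pev (C a) x = a :=
  eval_C _

lemma pev_prod {ι : Type*} (t : Finset ι) (p : ι → MvPolynomial (Fin 3) ℂ) (x : P2) :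
    pev (∏ i ∈ t, p i) x = ∏ i ∈ t, pev (p i) x :=
  map_prod _ _ _

lemma mem_plane_iff {n : ℕ} {A : ConicLineArrangement n} {x : P2} :
    x ∈ A.plane ↔ ∃ k, pev (A.f k) x = 0 :=
  Set.mem_iUnion

lemma BundleData.Valid.num_self {C : Set P2} {L : BundleData C} (hL : L.Valid) (a : L.ι) {x : P2}
    (hx : x ∈ C) (ha : pev (L.H a) x ≠ 0) : pev (L.num a a) x = pev (L.den a a) x := by
  obtain ⟨-, -, -, hne, hcoc⟩ := hL
  obtain ⟨h1, h2⟩ := hne a a x hx ha ha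
  refine mul_left_cancel₀ (mul_ne_zero h1 h2) ?_
  linear_combination hcoc a a a x hx ha ha ha

lemma IsTangencyDivisor.apply_eq_zero {Pt : Fin 4 → Fin 2 → P2} {i j : Fin 4} {D : P2 →₀ ℕ}
    (hD : IsTangencyDivisor Pt i j D) {x : P2} (hi : ∀ k, x ≠ Pt i k) (hj : ∀ k, x ≠ Pt j k) :
    D x = 0 := by
  rw [hD x, if_neg (hi 0), if_neg (hi 1), if_neg (hj 0), if_neg (hj 1)]

lemma IsTangencyDivisor.symm {Pt : Fin 4 → Fin 2 → P2} {i j : Fin 4} {D : P2 →₀ ℕ}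
    (hD : IsTangencyDivisor Pt i j D) : IsTangencyDivisor Pt j i D := fun P => by
  rw [hD P]
  ring

lemma IsTangencyDivisor.apply_eq_one {Pt : Fin 4 → Fin 2 → P2} {i j : Fin 4} {D : P2 →₀ ℕ}
    (hD : IsTangencyDivisor Pt i j D) (hinj : ∀ a b k k', Pt a k = Pt b k' → a = b ∧ k = k')
    (hij : i ≠ j) (k : Fin 2) : D (Pt i k) = 1 := by
  have h1 (k') : Pt i k ≠ Pt j k' := fun h => hij (hinj _ _ _ _ h).1
  rw [hD, if_neg (h1 0), if_neg (h1 1)]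
  fin_cases k
  · simp [show Pt i 0 ≠ Pt i 1 from fun h => absurd (hinj _ _ _ _ h).2 (by decide)]
  · simp [show Pt i 1 ≠ Pt i 0 from fun h => absurd (hinj _ _ _ _ h).2 (by decide)]

/-- A neighbourhood of the tangency point `P_{ak}` on the arrangement which lies on `C_k` and
contains no other zero of `F`. -/
lemma exists_isolating_form (A : ConicLineArrangement 2)
    {l : Fin 4 → MvPolynomial (Fin 3) ℂ} (hlhom : ∀ i, (l i).IsHomogeneous 1)
    {Pt : Fin 4 → Fin 2 → P2} {F : MvPolynomial (Fin 3) ℂ} {K : ℂ}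
    (hother : ∀ i k k', k ≠ k' → pev (A.f k') (Pt i k) ≠ 0)
    (hline : ∀ i j k, i ≠ j → pev (l j) (Pt i k) ≠ 0)
    (huniq : ∀ i k x, pev (l i) x = 0 → pev (A.f k) x = 0 → x = Pt i k)
    (hK : K ≠ 0) (hFK : ∀ x ∈ A.plane, pev F x ^ 2 = K * ∏ i, pev (l i) x) (a : Fin 4)
    (k : Fin 2) :
    ∃ (E : MvPolynomial (Fin 3) ℂ) (e : ℕ), E.IsHomogeneous e ∧ pev E (Pt a k) ≠ 0 ∧
      ∀ y ∈ A.plane, pev E y ≠ 0 → pev (A.f k) y = 0 ∧ (pev F y ≠ 0 ∨ y = Pt a k) := by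
  have hk : k ≠ k + 1 := by fin_cases k <;> decide
  refine ⟨A.f (k + 1) * ∏ b ∈ Finset.univ.erase a, l b, _,
    (A.homog _).mul (IsHomogeneous.prod _ _ _ fun b _ => hlhom b), ?_, fun y hy hE => ?_⟩
  · rw [pev_mul, pev_prod]
    exact mul_ne_zero (hother _ _ _ hk) (Finset.prod_ne_zero_iff.2 fun b hb =>
      hline _ _ _ (Finset.ne_of_mem_erase hb).symm)
  · rw [pev_mul, pev_prod] at hE
    obtain ⟨hE1, hE2⟩ := mul_ne_zero_iff.1 hE
    have hfy : pev (A.f k) y = 0 := by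
      obtain ⟨k', hk'⟩ := mem_plane_iff.1 hy
      have : k' = k ∨ k' = k + 1 := by
        clear * -
        decide +revert
      rcases this with rfl | rfl
      · exact hk'
      · exact absurd hk' hE1
    refine ⟨hfy, or_iff_not_imp_left.2 fun hF => huniq a k y ?_ hfy⟩
    have h0 := hFK y hy
    rw [not_not.1 hF, ← Finset.mul_prod_erase _ _ (Finset.mem_univ a)] at h0
    have := mul_eq_zero.1 (by linear_combination -h0 :
      (K * ∏ b ∈ Finset.univ.erase a, pev (l b) y) * pev (l a) y = 0)
    exact this.resolve_left (mul_ne_zero hK hE2)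

/-- If `σ = X b * p / q` and `σ' = X b' * p' / q'` are local sections whose divisors are those of
the tangency points on `T_i, T_j` and on `T_k, T_m`, then `σ' * F / (σ * l k * l m)` is, near each
point, a quotient of forms which do not vanish at this point. -/
lemma exists_local_quotient (A : ConicLineArrangement 2)
    {l : Fin 4 → MvPolynomial (Fin 3) ℂ} (hlhom : ∀ i, (l i).IsHomogeneous 1)
    {Pt : Fin 4 → Fin 2 → P2} (htan : ∀ i k, IsTangentLineAt (l i) (A.f k) (Pt i k))
    {F : MvPolynomial (Fin 3) ℂ} {K : ℂ}
    (hother : ∀ i k k', k ≠ k' → pev (A.f k') (Pt i k) ≠ 0)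
    (hline : ∀ i j k, i ≠ j → pev (l j) (Pt i k) ≠ 0)
    (huniq : ∀ i k x, pev (l i) x = 0 → pev (A.f k) x = 0 → x = Pt i k)
    (hF : F.IsHomogeneous 2) (hK : K ≠ 0)
    (hFK : ∀ x ∈ A.plane, pev F x ^ 2 = K * ∏ i, pev (l i) x)
    (hloc : ∀ i k G d, G.IsHomogeneous d → OrdEq (A.f 0 * A.f 1) (Pt i k) G 1 →
        ∃ (u h : MvPolynomial (Fin 3) ℂ) (e e' : ℕ), u.IsHomogeneous e ∧ h.IsHomogeneous e' ∧
          e + 2 = e' + d ∧ pev u (Pt i k) ≠ 0 ∧ pev h (Pt i k) ≠ 0 ∧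
          ∀ x, pev (A.f k) x = 0 → pev u x * pev F x = pev h x * pev G x)
    {i j k m : Fin 4} (hpart : ({i, j, k, m} : Finset (Fin 4)) = Finset.univ)
    {D D' : P2 →₀ ℕ} (hD : IsTangencyDivisor Pt i j D) (hD' : IsTangencyDivisor Pt k m D')
    {b b' : Fin 3} {p q p' q' : MvPolynomial (Fin 3) ℂ} {d d' : ℕ}
    (hp : p.IsHomogeneous d) (hq : q.IsHomogeneous d) (hp' : p'.IsHomogeneous d')
    (hq' : q'.IsHomogeneous d') {x : P2} (hx : x ∈ A.plane)
    (hb : pev (X b) x ≠ 0) (hb' : pev (X b') x ≠ 0) (hqx : pev q x ≠ 0) (hqx' : pev q' x ≠ 0)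
    (hord : OrdEq (A.f 0 * A.f 1) x p (D x)) (hord' : OrdEq (A.f 0 * A.f 1) x p' (D' x)) :
    ∃ (r t E : MvPolynomial (Fin 3) ℂ) (e e' : ℕ), r.IsHomogeneous e ∧ t.IsHomogeneous e ∧
      E.IsHomogeneous e' ∧ pev r x ≠ 0 ∧ pev t x ≠ 0 ∧ pev E x ≠ 0 ∧
      ∀ y ∈ A.plane, pev E y ≠ 0 → (pev F y ≠ 0 ∨ y = x) ∧
        pev r y * (pev (X b) y * pev p y) * pev q' y * (pev (l k) y * pev (l m) y) =
          pev t y * (pev (X b') y * pev p' y) * pev q y * pev F y := by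
  obtain ⟨hij, hik, him, hjk, hjm, hkm⟩ := pairwise_ne_of_insert_eq_univ hpart
  have hprod (y : P2) : ∏ a, pev (l a) y =
      pev (l i) y * pev (l j) y * (pev (l k) y * pev (l m) y) := by
    rw [← hpart, Finset.prod_insert (by simp [hij, hik, him]),
      Finset.prod_insert (by simp [hjk, hjm]), Finset.prod_insert (by simp [hkm]),
      Finset.prod_singleton]
    ring
  have hinj (a b : Fin 4) (k k' : Fin 2) (h : Pt a k = Pt b k') : a = b ∧ k = k' := by
    constructor
    · by_contra hab
      exact hline a b k hab (h ▸ (htan b k').1)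
    · by_contra hkk
      exact hother a k k' hkk (h ▸ (htan b k').2.1)
  have hX (b : Fin 3) : (X b : MvPolynomial (Fin 3) ℂ).IsHomogeneous 1 := isHomogeneous_X _ _
  by_cases hFx : pev F x = 0
  · obtain ⟨n, hn⟩ := mem_plane_iff.1 hx
    have h0 := hFK x hx
    rw [hFx, zero_pow two_ne_zero, eq_comm, mul_eq_zero, Finset.prod_eq_zero_iff] at h0
    obtain ⟨a, -, ha⟩ := h0.resolve_left hK
    obtain rfl := huniq a n x ha hn
    obtain ⟨E, e', hE, hEx, hEy⟩ :=
      exists_isolating_form A hlhom hother hline huniq hK hFK a n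
    have ha : a = i ∨ a = j ∨ a = k ∨ a = m := by
      have := Finset.mem_univ a
      rw [← hpart] at this
      simpa using this
    rcases or_assoc.2 ha with ha | ha
    · have hD1 : D (Pt a n) = 1 := by
        rcases ha with rfl | rfl
        · exact hD.apply_eq_one hinj hij n
        · exact hD.symm.apply_eq_one hinj hij.symm n
      have hak : a ≠ k := by
        rcases ha with rfl | rfl
        exacts [hik, hjk]
      have ham : a ≠ m := by
        rcases ha with rfl | rfl
        exacts [him, hjm]
      have hD0 : D' (Pt a n) = 0 :=
        hD'.apply_eq_zero (fun k' h => hak (hinj _ _ _ _ h).1) fun k' h => ham (hinj _ _ _ _ h).1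
      rw [hD1] at hord
      rw [hD0] at hord'
      obtain ⟨u, h, e₁, e₂, hu, hh, hdeg, hux, hhx, huh⟩ := hloc a n p d hp hord
      refine ⟨X b' * p' * q * h, X b * u * q' * (l k * l m), E, 1 + d' + d + e₂, e',
        (((hX b').mul hp').mul hq).mul hh, ?_, hE, ?_, ?_, hEx, fun y hy hEy' => ?_⟩
      · convert (((hX b).mul hu).mul hq').mul ((hlhom k).mul (hlhom m)) using 1
        omega
      · simp only [pev_mul]
        exact mul_ne_zero (mul_ne_zero (mul_ne_zero hb'
          (pev_ne_zero_of_ordEq_zero hp' hord')) hqx) hhx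
      · simp only [pev_mul]
        exact mul_ne_zero (mul_ne_zero (mul_ne_zero hb hux) hqx')
          (mul_ne_zero (hline _ _ _ hak) (hline _ _ _ ham))
      · obtain ⟨hfy, hy'⟩ := hEy y hy hEy'
        refine ⟨hy', ?_⟩
        simp only [pev_mul]
        linear_combination -(pev (X b) y * pev (X b') y * pev p' y * pev q y * pev q' y *
          (pev (l k) y * pev (l m) y)) * huh y hfy
    · have hD1 : D' (Pt a n) = 1 := by
        rcases ha with rfl | rfl
        · exact hD'.apply_eq_one hinj hkm n
        · exact hD'.symm.apply_eq_one hinj hkm.symm n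
      have hai : a ≠ i := by
        rcases ha with rfl | rfl
        exacts [hik.symm, him.symm]
      have haj : a ≠ j := by
        rcases ha with rfl | rfl
        exacts [hjk.symm, hjm.symm]
      have hD0 : D (Pt a n) = 0 :=
        hD.apply_eq_zero (fun k' h => hai (hinj _ _ _ _ h).1) fun k' h => haj (hinj _ _ _ _ h).1
      rw [hD0] at hord
      rw [hD1] at hord'
      obtain ⟨u, h, e₁, e₂, hu, hh, hdeg, hux, hhx, huh⟩ := hloc a n p' d' hp' hord'
      refine ⟨X b' * u * q * (C K * (l i * l j)), X b * h * p * q', E, 1 + e₂ + d + d', e',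
        ?_, (((hX b).mul hh).mul hp).mul hq', hE, ?_, ?_, hEx, fun y hy hEy' => ?_⟩
      · convert (((hX b').mul hu).mul hq).mul
          ((isHomogeneous_C _ K).mul ((hlhom i).mul (hlhom j))) using 1
        omega
      · simp only [pev_mul, pev_C]
        exact mul_ne_zero (mul_ne_zero (mul_ne_zero hb' hux) hqx)
          (mul_ne_zero hK (mul_ne_zero (hline _ _ _ hai) (hline _ _ _ haj)))
      · simp only [pev_mul]
        exact mul_ne_zero (mul_ne_zero (mul_ne_zero hb hhx)
          (pev_ne_zero_of_ordEq_zero hp hord)) hqx'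
      · obtain ⟨hfy, hy'⟩ := hEy y hy hEy'
        refine ⟨hy', ?_⟩
        have hFy := hFK y hy
        rw [hprod] at hFy
        simp only [pev_mul, pev_C]
        linear_combination pev (X b) y * pev (X b') y * pev p y * pev q y * pev q' y *
          (pev F y * huh y hfy - pev u y * hFy)
  · have hl0 : pev (l i) x * pev (l j) x * (pev (l k) x * pev (l m) x) ≠ 0 := by
      intro h0
      have := hFK x hx
      rw [hprod, h0, mul_zero] at this
      exact hFx (pow_eq_zero_iff two_ne_zero |>.1 this)
    have hPt (a : Fin 4) (ha : pev (l a) x ≠ 0) (n : Fin 2) : x ≠ Pt a n := fun h =>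
      ha (h ▸ (htan a n).1)
    obtain ⟨hlij, hlkm⟩ := mul_ne_zero_iff.1 hl0
    obtain ⟨hli, hlj⟩ := mul_ne_zero_iff.1 hlij
    obtain ⟨hlk, hlm⟩ := mul_ne_zero_iff.1 hlkm
    rw [hD.apply_eq_zero (hPt i hli) (hPt j hlj)] at hord
    rw [hD'.apply_eq_zero (hPt k hlk) (hPt m hlm)] at hord'
    refine ⟨X b' * p' * q * F, X b * p * q' * (l k * l m), F, 1 + d' + d + 2, 2,
      (((hX b').mul hp').mul hq).mul hF, ?_, hF, ?_, ?_, hFx, fun y hy hEy => ⟨.inl hEy, ?_⟩⟩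
    · convert (((hX b).mul hp).mul hq').mul ((hlhom k).mul (hlhom m)) using 1
      omega
    · simp only [pev_mul]
      exact mul_ne_zero (mul_ne_zero (mul_ne_zero hb'
        (pev_ne_zero_of_ordEq_zero hp' hord')) hqx) hFx
    · simp only [pev_mul]
      exact mul_ne_zero (mul_ne_zero (mul_ne_zero hb
        (pev_ne_zero_of_ordEq_zero hp hord)) hqx') hlkm
    · simp only [pev_mul]
      ring

/-- The transition identity for the quotient of two sections, from those of the sections. -/
lemma quotient_transition {N D N' D' X₁ X₂ X₁' X₂' p₁ p₂ q₁ q₂ p₁' p₂' q₁' q₂' r₁ r₂ t₁ t₂ F G : ℂ}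
    (hX₁ : X₁ ≠ 0) (hX₂ : X₂ ≠ 0) (hp₁ : p₁ ≠ 0) (hp₂ : p₂ ≠ 0) (hq₁' : q₁' ≠ 0) (hq₂' : q₂' ≠ 0)
    (hG : G ≠ 0) (h : D * X₂ * p₂ * q₁ = N * X₁ * q₂ * p₁)
    (h' : D' * X₂' * p₂' * q₁' = N' * X₁' * q₂' * p₁')
    (h₁ : r₁ * (X₁ * p₁) * q₁' * G = t₁ * (X₁' * p₁') * q₁ * F)
    (h₂ : r₂ * (X₂ * p₂) * q₂' * G = t₂ * (X₂' * p₂') * q₂ * F) :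
    N * D' * r₂ * t₁ = D * N' * t₂ * r₁ := by
  have hM : X₁ * p₁ * X₂ * p₂ * q₁' * q₂' * G ≠ 0 := by simp [*]
  refine mul_left_cancel₀ hM ?_
  linear_combination N * D' * t₁ * X₁ * p₁ * q₁' * h₂ - D * N' * t₂ * X₂ * p₂ * q₂' * h₁ +
    F * t₁ * t₂ * (N * X₁ * p₁ * q₂ * h' - N' * X₁' * p₁' * q₂' * h)

end QuotientSection

section Statement13

/-- Let `C₁, C₂ ⊂ ℙ²(ℂ)` be smooth conics intersecting transversely,
`C = C₁ + C₂`, let `T₁, …, T₄` be the four common bitangent lines with tangency points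
`P_{ik} = T_i ∩ C_k`, and for `i ≠ j` let
`ℱ_{ij} = 𝒪_{ℙ²}(1)|_C ⊗ 𝒪_C(-P_{i1}-P_{i2}-P_{j1}-P_{j2})`.  Then for any partition
`{i, j, k, m} = {1, 2, 3, 4}` one has `ℱ_{ij} ≅ ℱ_{km}`. -/
theorem statement13 (A : ConicLineArrangement 2) (hdeg : ∀ i, A.deg i = 2)
    (l : Fin 4 → MvPolynomial (Fin 3) ℂ)
    (hlhom : ∀ i, (l i).IsHomogeneous 1) (hlne : ∀ i, l i ≠ 0)
    (hldist : ∀ i j, i ≠ j → zeroLocus (l i) ≠ zeroLocus (l j))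
    (Pt : Fin 4 → Fin 2 → P2)
    (htan : ∀ i kk, IsTangentLineAt (l i) (A.f kk) (Pt i kk))
    (i j k m : Fin 4)
    (hpart : ({i, j, k, m} : Finset (Fin 4)) = Finset.univ)
    (hij : i ≠ j) (hkm : k ≠ m)
    (Dij Dkm : P2 →₀ ℕ) (Lij Lkm : BundleData A.plane)
    (hDij : IsTangencyDivisor Pt i j Dij) (hDkm : IsTangencyDivisor Pt k m Dkm)
    (hLij : Lij.Valid) (hLkm : Lkm.Valid)
    (hrij : RepOdMinus A.plane (A.f 0 * A.f 1) 1 Lij Dij)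
    (hrkm : RepOdMinus A.plane (A.f 0 * A.f 1) 1 Lkm Dkm) :
    BIso Lij Lkm := by
  obtain ⟨hother, hline, huniq, F, K, hF, hK, hFK, hloc⟩ :=
    exists_conic_through_tangency_points A hdeg hlhom hlne hldist htan
  obtain ⟨s, ⟨hsK, hscov, hsH, hsdeg, hsden, hstr⟩, -, hsord⟩ := hrij
  obtain ⟨s', ⟨hsK', hscov', hsH', hsdeg', hsden', hstr'⟩, -, hsord'⟩ := hrkm
  choose c hc using fun x : {x : P2 // x ∈ A.plane} => hscov x x.2
  choose c' hc' using fun x : {x : P2 // x ∈ A.plane} => hscov' x x.2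
  have hH (a : s.σ) (x : P2) (hx : x ∈ A.plane) (h : pev (s.K a) x ≠ 0) :
      pev (Lij.H (s.toChart a).1) x ≠ 0 ∧ pev (X (s.toChart a).2) x ≠ 0 := by
    have := hsH a x hx h
    simpa only [BundleData.tensor, BundleData.dual, OdC, pev_mul, mul_ne_zero_iff] using this
  have hH' (a : s'.σ) (x : P2) (hx : x ∈ A.plane) (h : pev (s'.K a) x ≠ 0) :
      pev (Lkm.H (s'.toChart a).1) x ≠ 0 ∧ pev (X (s'.toChart a).2) x ≠ 0 := by
    have := hsH' a x hx h
    simpa only [BundleData.tensor, BundleData.dual, OdC, pev_mul, mul_ne_zero_iff] using this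
  choose r t E e e' hr ht hE hrx htx hEx hrel using fun x : {x : P2 // x ∈ A.plane} =>
    exists_local_quotient A hlhom htan hother hline huniq hF hK hFK hloc hpart hDij hDkm
      (hsdeg (c x)).1 (hsdeg (c x)).2 (hsdeg' (c' x)).1 (hsdeg' (c' x)).2 x.2
      (hH (c x) x x.2 (hc x)).2 (hH' (c' x) x x.2 (hc' x)).2 (hsden (c x) x x.2 (hc x))
      (hsden' (c' x) x x.2 (hc' x)) (hsord x x.2 (c x) (hc x)) (hsord' x x.2 (c' x) (hc' x))
  let T : TrivData (Lij.tensor Lkm.dual) :=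
    { σ := {x : P2 // x ∈ A.plane}
      K := fun x => s.K (c x) * s'.K (c' x) * (r x * t x * E x)
      Kdeg := fun x => s.Kdeg (c x) + s'.Kdeg (c' x) + (e x + e x + e' x)
      toChart := fun x => ((s.toChart (c x)).1, (s'.toChart (c' x)).1)
      lnum := r
      lden := t
      ldeg := e }
  have hTK (x : {x : P2 // x ∈ A.plane}) (y : P2) (h : pev (T.K x) y ≠ 0) :
      (pev (s.K (c x)) y ≠ 0 ∧ pev (s'.K (c' x)) y ≠ 0) ∧
        (pev (r x) y ≠ 0 ∧ pev (t x) y ≠ 0) ∧ pev (E x) y ≠ 0 := by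
    simpa only [T, pev_mul, mul_ne_zero_iff] using h
  refine ⟨T, ⟨fun x => ((hsK _).mul (hsK' _)).mul (((hr x).mul (ht x)).mul (hE x)),
    fun x hx => ⟨⟨x, hx⟩, ?_⟩, fun x y hy h => ?_, fun x => ⟨hr x, ht x⟩,
    fun x y _ h => (hTK x y h).2.1.2, fun x₁ x₂ y hy h₁ h₂ => ?_⟩,
    fun x y _ h => (hTK x y h).2.1.1⟩
  · simp only [T, pev_mul, mul_ne_zero_iff]
    exact ⟨⟨hc ⟨x, hx⟩, hc' ⟨x, hx⟩⟩, ⟨hrx ⟨x, hx⟩, htx ⟨x, hx⟩⟩, hEx ⟨x, hx⟩⟩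
  · simp only [T, BundleData.tensor, BundleData.dual, pev_mul]
    exact mul_ne_zero (hH _ y hy (hTK x y h).1.1).1 (hH' _ y hy (hTK x y h).1.2).1
  · obtain ⟨⟨hc₁, hc₁'⟩, ⟨hr₁, ht₁⟩, hE₁⟩ := hTK x₁ y h₁
    obtain ⟨⟨hc₂, hc₂'⟩, ⟨hr₂, ht₂⟩, hE₂⟩ := hTK x₂ y h₂
    obtain ⟨hy₁, hrel₁⟩ := hrel x₁ y hy hE₁
    obtain ⟨hy₂, hrel₂⟩ := hrel x₂ y hy hE₂
    simp only [T, BundleData.tensor, BundleData.dual, pev_mul]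
    by_cases hFy : pev F y = 0
    · obtain rfl : x₁ = x₂ := Subtype.ext
        ((hy₁.resolve_left (not_not.2 hFy)).symm.trans (hy₂.resolve_left (not_not.2 hFy)))
      rw [hLij.num_self _ hy (hH _ y hy hc₁).1, hLkm.num_self _ hy (hH' _ y hy hc₁').1]
      ring
    · have hl (a : Fin 4) : pev (l a) y ≠ 0 := fun h => hFy <| by
        have := hFK y hy
        rw [Finset.prod_eq_zero (Finset.mem_univ a) h, mul_zero] at this
        exact pow_eq_zero_iff two_ne_zero |>.1 this
      have hPt (a : Fin 4) (n : Fin 2) : y ≠ Pt a n := fun h => hl a (h ▸ (htan a n).1)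
      have hp (a : s.σ) (ha : pev (s.K a) y ≠ 0) : pev (s.lnum a) y ≠ 0 := by
        have := hsord y hy a ha
        rw [hDij.apply_eq_zero (hPt i) (hPt j)] at this
        exact pev_ne_zero_of_ordEq_zero (hsdeg a).1 this
      have h := hstr (c x₁) (c x₂) y hy hc₁ hc₂
      have h' := hstr' (c' x₁) (c' x₂) y hy hc₁' hc₂'
      simp only [BundleData.tensor, BundleData.dual, OdC, pev_mul, pow_one] at h h'
      exact quotient_transition (hH _ y hy hc₁).2 (hH _ y hy hc₂).2 (hp _ hc₁) (hp _ hc₂)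
        (hsden' _ y hy hc₁') (hsden' _ y hy hc₂') (mul_ne_zero (hl k) (hl m)) h h' hrel₁ hrel₂

end Statement13

end
end

section
/- (Salmon's theorem) Let C₁, C₂ ⊂ ℙ²(ℂ) be smooth conics intersecting transversely, let T₁, T₂, T₃, T₄ be their four common bitangent lines, and let P_{ik} = T_i ∩ C_k (i = 1,…,4; k = 1,2) be the eight points of tangency. Then 𝒪_C(∑_{i=1}^{4}(P_{i1} + P_{i2})) ≅ 𝒪_{ℙ²}(2)|_C, where C = C₁ + C₂; in particular, the eight tangency points P_{11}, P_{12}, …, P_{41}, P_{42} all lie on a single conic in ℙ². -/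
/-!
Basic setup: the complex projective plane, plane curves, conic-line arrangements
with simple nodes, topological double covers and gluing data.
-/

open MvPolynomial

noncomputable section

section Statement15

open Classical in
/-- `E` is the divisor `∑_{i=1}^{4} (P_{i1} + P_{i2})` of all eight tangency points. -/
def IsAllTangencyDivisor (Pt : Fin 4 → Fin 2 → P2) (E : P2 →₀ ℕ) : Prop :=
  ∀ P : P2, E P = ∑ i : Fin 4, ∑ kk : Fin 2, (if P = Pt i kk then 1 else 0)

open Matrix in
lemma dotProduct_mulVec_comm_of_isSymm_s15 {B : Matrix (Fin 3) (Fin 3) ℂ} (hB : B.IsSymm)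
    (u v : Fin 3 → ℂ) : u ⬝ᵥ B *ᵥ v = v ⬝ᵥ B *ᵥ u := by
  rw [dotProduct_mulVec, dotProduct_comm, ← mulVec_transpose, hB.eq]

open Matrix in
/-- A nondegenerate ternary quadratic form has no isotropic plane. -/
lemma crossProduct_eq_zero_of_isotropic {B : Matrix (Fin 3) (Fin 3) ℂ} (hB : B.IsSymm)
    (hdet : B.det ≠ 0) {u v : Fin 3 → ℂ} (hu : u ⬝ᵥ B *ᵥ u = 0) (hv : v ⬝ᵥ B *ᵥ v = 0)
    (huv : u ⬝ᵥ B *ᵥ v = 0) : u ⨯₃ v = 0 := by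
  have key : ∀ w : Fin 3 → ℂ, (Matrix.of ![u, v, w]).det = 0 := by
    intro w
    set U := Matrix.of ![u, v, w] with hU
    have hM : ∀ i j, (U * B * Uᵀ) i j = U i ⬝ᵥ B *ᵥ U j := by
      intro i j
      rw [dotProduct_mulVec]
      rfl
    have h0 : (U * B * Uᵀ).det = 0 := by
      rw [det_fin_three]
      have hvu : v ⬝ᵥ B *ᵥ u = 0 := by rw [dotProduct_mulVec_comm_of_isSymm_s15 hB, huv]
      have hU0 : U 0 = u := rfl
      have hU1 : U 1 = v := rfl
      simp [hM, hU0, hU1, hu, hv, huv, hvu]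
    rw [det_mul, det_mul, det_transpose] at h0
    simpa [hdet] using h0
  have h0 := key (Pi.single 0 1)
  have h1 := key (Pi.single 1 1)
  have h2 := key (Pi.single 2 1)
  simp [det_fin_three] at h0 h1 h2
  rw [cross_apply]
  ext m
  fin_cases m
  · simpa using h0
  · simp
    linear_combination h1
  · simpa using h2

open Matrix in
lemma crossProduct_ne_zero_of_forall_ne_smul {u v : Fin 3 → ℂ} (hu : u ≠ 0)
    (huv : ∀ c : ℂ, v ≠ c • u) : u ⨯₃ v ≠ 0 := by
  rw [crossProduct_ne_zero_iff_linearIndependent, LinearIndependent.pair_iff' hu]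
  exact fun c h => huv c h.symm

open Matrix in
/-- Three distinct points of a smooth conic are not collinear. -/
lemma det_ne_zero_of_isotropic {B : Matrix (Fin 3) (Fin 3) ℂ} (hB : B.IsSymm)
    (hdet : B.det ≠ 0) {ι : Type*} {w : ι → Fin 3 → ℂ}
    (hw : ∀ i j, i ≠ j → ∀ c : ℂ, w i ≠ c • w j) (hiso : ∀ i, w i ⬝ᵥ B *ᵥ w i = 0)
    {i j k : ι} (hij : i ≠ j) (hik : i ≠ k) (hjk : j ≠ k) :
    (Matrix.of ![w i, w j, w k]).det ≠ 0 := by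
  intro h
  obtain ⟨x, hx, hx0⟩ := exists_vecMul_eq_zero_iff.2 h
  have hrel : x 0 • w i + x 1 • w j + x 2 • w k = 0 := by
    rw [← hx0]
    ext m
    simp [vecMul, dotProduct, Fin.sum_univ_three]
  have hwi : w i ≠ 0 := fun h0 => hw i j hij 0 (by rw [h0, zero_smul])
  have hcross := crossProduct_ne_zero_of_forall_ne_smul hwi (hw j i hij.symm)
  have hli := (crossProduct_ne_zero_iff_linearIndependent.1 hcross)
  have h2 : x 2 ≠ 0 := by
    intro h2
    rw [h2, zero_smul, add_zero] at hrel
    have := LinearIndependent.pair_iff.1 hli _ _ hrel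
    apply hx
    ext m
    fin_cases m <;> simp [this, h2]
  obtain ⟨a, b, hab⟩ : ∃ a b : ℂ, w k = a • w i + b • w j := by
    refine ⟨-x 0 / x 2, -x 1 / x 2, ?_⟩
    ext m
    have := congrFun hrel m
    simp at this ⊢
    field_simp
    linear_combination this
  have ha : a ≠ 0 := by
    rintro rfl
    exact hw k j hjk.symm b (by simpa using hab)
  have hb : b ≠ 0 := by
    rintro rfl
    exact hw k i hik.symm a (by simpa using hab)
  have hk := hiso k
  rw [hab] at hk
  simp only [mulVec_add, mulVec_smul, dotProduct_add, add_dotProduct, smul_dotProduct,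
    dotProduct_smul, hiso, dotProduct_mulVec_comm_of_isSymm_s15 hB (w j) (w i), smul_eq_mul] at hk
  have h0 : w i ⬝ᵥ B *ᵥ w j = 0 := by
    have : (2 * a * b) * (w i ⬝ᵥ B *ᵥ w j) = 0 := by linear_combination hk
    simpa [ha, hb] using this
  exact hcross (crossProduct_eq_zero_of_isotropic hB hdet (hiso i) (hiso j) h0)

open Matrix in
/-- A conic meeting a smooth conic in five points is proportional to it. -/
lemma exists_eq_smul_of_isotropic {B D : Matrix (Fin 3) (Fin 3) ℂ} (hB : B.IsSymm)
    (hD : D.IsSymm) (hdet : B.det ≠ 0) {w : Fin 5 → Fin 3 → ℂ}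
    (hw : ∀ i j, i ≠ j → ∀ c : ℂ, w i ≠ c • w j) (hwB : ∀ i, w i ⬝ᵥ B *ᵥ w i = 0)
    (hwD : ∀ i, w i ⬝ᵥ D *ᵥ w i = 0) : ∃ c : ℂ, D = c • B := by
  have h3 : ∀ i j k : Fin 5, i ≠ j → i ≠ k → j ≠ k → (Matrix.of ![w i, w j, w k]).det ≠ 0 :=
    fun i j k => det_ne_zero_of_isotropic hB hdet hw hwB
  have hb : w 0 ⬝ᵥ B *ᵥ w 1 ≠ 0 := by
    intro h
    have h0 : w 0 ≠ 0 := fun h0 => hw 0 1 (by decide) 0 (by rw [h0, zero_smul])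
    exact crossProduct_ne_zero_of_forall_ne_smul h0 (hw 1 0 (by decide))
      (crossProduct_eq_zero_of_isotropic hB hdet (hwB 0) (hwB 1) h)
  refine ⟨(w 0 ⬝ᵥ D *ᵥ w 1) / (w 0 ⬝ᵥ B *ᵥ w 1), ?_⟩
  set c := (w 0 ⬝ᵥ D *ᵥ w 1) / (w 0 ⬝ᵥ B *ᵥ w 1) with hc
  set E := D - c • B with hE
  have hEs : E.IsSymm := hD.sub (hB.smul c)
  have hiso : ∀ i, w i ⬝ᵥ E *ᵥ w i = 0 := by
    intro i
    simp [hE, sub_mulVec, smul_mulVec, hwB, hwD]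
  have h01 : w 0 ⬝ᵥ E *ᵥ w 1 = 0 := by
    simp only [hE, sub_mulVec, smul_mulVec, dotProduct_sub, dotProduct_smul, smul_eq_mul, hc]
    field_simp
    ring
  set U := Matrix.of ![w 0, w 1, w 2] with hU
  have hUdet : U.det ≠ 0 := h3 0 1 2 (by decide) (by decide) (by decide)
  have hcomb : ∀ v : Fin 3 → ℂ, ∃ x y z : ℂ, v = x • w 0 + y • w 1 + z • w 2 := by
    intro v
    refine ⟨(v ᵥ* U⁻¹) 0, (v ᵥ* U⁻¹) 1, (v ᵥ* U⁻¹) 2, ?_⟩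
    have h : (v ᵥ* U⁻¹) ᵥ* U = v := by
      rw [vecMul_vecMul, nonsing_inv_mul _ (isUnit_iff_ne_zero.2 hUdet), vecMul_one]
    nth_rewrite 1 [← h]
    generalize v ᵥ* U⁻¹ = t
    ext m
    simp [vecMul, dotProduct, Fin.sum_univ_three, hU]
  obtain ⟨x, y, z, hxyz⟩ := hcomb (w 3)
  obtain ⟨x', y', z', hxyz'⟩ := hcomb (w 4)
  have hz : z ≠ 0 := by
    rintro rfl
    apply h3 0 1 3 (by decide) (by decide) (by decide)
    rw [hxyz, det_fin_three]
    simp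
    ring
  have hz' : z' ≠ 0 := by
    rintro rfl
    apply h3 0 1 4 (by decide) (by decide) (by decide)
    rw [hxyz', det_fin_three]
    simp
    ring
  have hxy : x * y' - x' * y ≠ 0 := by
    intro h
    apply h3 2 3 4 (by decide) (by decide) (by decide)
    have : (Matrix.of ![w 2, w 3, w 4]).det = (x * y' - x' * y) * U.det := by
      rw [hxyz, hxyz', hU, det_fin_three, det_fin_three]
      simp
      ring
    rw [this, h, zero_mul]
  have hline : ∀ {a b d : ℂ} {i : Fin 5}, d ≠ 0 → w i = a • w 0 + b • w 1 + d • w 2 →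
      a * (w 0 ⬝ᵥ E *ᵥ w 2) + b * (w 1 ⬝ᵥ E *ᵥ w 2) = 0 := by
    intro a b d i hd hi
    have h := hiso i
    rw [hi] at h
    simp only [mulVec_add, mulVec_smul, dotProduct_add, add_dotProduct, smul_dotProduct,
      dotProduct_smul, hiso, dotProduct_mulVec_comm_of_isSymm_s15 hEs (w 1) (w 0),
      dotProduct_mulVec_comm_of_isSymm_s15 hEs (w 2) (w 0),
      dotProduct_mulVec_comm_of_isSymm_s15 hEs (w 2) (w 1), smul_eq_mul, h01] at h
    have : (2 * d) * (a * (w 0 ⬝ᵥ E *ᵥ w 2) + b * (w 1 ⬝ᵥ E *ᵥ w 2)) = 0 := by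
      linear_combination h
    simpa [hd] using this
  have e1 := hline hz hxyz
  have e2 := hline hz' hxyz'
  have h02 : w 0 ⬝ᵥ E *ᵥ w 2 = 0 :=
    (mul_eq_zero.1 (by linear_combination y' * e1 - y * e2 :
      (x * y' - x' * y) * (w 0 ⬝ᵥ E *ᵥ w 2) = 0)).resolve_left hxy
  have h12 : w 1 ⬝ᵥ E *ᵥ w 2 = 0 :=
    (mul_eq_zero.1 (by linear_combination x * e2 - x' * e1 :
      (x * y' - x' * y) * (w 1 ⬝ᵥ E *ᵥ w 2) = 0)).resolve_left hxy
  have hzero : U * E * Uᵀ = 0 := by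
    ext i j
    have hM : (U * E * Uᵀ) i j = U i ⬝ᵥ E *ᵥ U j := by
      rw [dotProduct_mulVec]
      rfl
    have hU0 : U 0 = w 0 := rfl
    have hU1 : U 1 = w 1 := rfl
    have hU2 : U 2 = w 2 := rfl
    rw [hM]
    fin_cases i <;> fin_cases j <;>
      simp [hU0, hU1, hU2, hiso, h01, h02, h12, dotProduct_mulVec_comm_of_isSymm_s15 hEs (w 1) (w 0),
        dotProduct_mulVec_comm_of_isSymm_s15 hEs (w 2) (w 0),
        dotProduct_mulVec_comm_of_isSymm_s15 hEs (w 2) (w 1)]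
  have hUu : IsUnit U := (isUnit_iff_isUnit_det U).2 (isUnit_iff_ne_zero.2 hUdet)
  have hUt : IsUnit Uᵀ := (isUnit_transpose U).2 hUu
  have : E = 0 := by
    rwa [hUt.mul_left_eq_zero, hUu.mul_right_eq_zero] at hzero
  exact sub_eq_zero.1 this

open Matrix in
/-- The matrix of the conic through the eight points of tangency of the common tangents
of two smooth conics. -/
lemma exists_tangency_conic {A B : Matrix (Fin 3) (Fin 3) ℂ} (hA : A.IsSymm) (hB : B.IsSymm)
    (hAd : A.det ≠ 0) (hBd : B.det ≠ 0) :
    ∃ (G : Matrix (Fin 3) (Fin 3) ℂ) (a b c d : ℂ), G.IsSymm ∧ b ≠ 0 ∧ d ≠ 0 ∧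
      G = a • A + b • (A * B⁻¹ * A) ∧ G = c • B + d • (B * A⁻¹ * B) := by
  have hAu : IsUnit A.det := isUnit_iff_ne_zero.2 hAd
  have hBu : IsUnit B.det := isUnit_iff_ne_zero.2 hBd
  set M := A⁻¹ * B with hM
  have hdeg : M.charpoly.natDegree = 3 := by simp [charpoly_natDegree_eq_dim]
  have hch := aeval_self_charpoly M
  have h3 : M.charpoly.coeff 3 = 1 := by
    have := charpoly_monic M
    rwa [Polynomial.Monic, Polynomial.leadingCoeff, hdeg] at this
  rw [Polynomial.aeval_eq_sum_range, hdeg] at hch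
  simp only [Finset.sum_range_succ, Finset.sum_range_zero, h3, zero_add, pow_zero, pow_one,
    one_smul] at hch
  have h0 : M.charpoly.coeff 0 ≠ 0 := by
    intro h
    have hMd := det_eq_sign_charpoly_coeff M
    rw [h, mul_zero, hM, det_mul, det_nonsing_inv] at hMd
    simp [hAd, hBd] at hMd
  have hAM : A * M = B := by rw [hM, mul_nonsing_inv_cancel_left _ _ hAu]
  have hMBA : M * (B⁻¹ * A) = 1 := by
    rw [hM, Matrix.mul_assoc, mul_nonsing_inv_cancel_left _ _ hBu, nonsing_inv_mul _ hAu]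
  have hrel := congrArg (fun N => A * N * (B⁻¹ * A)) hch
  simp only [mul_add, add_mul, mul_smul_comm, smul_mul_assoc, mul_one, mul_zero, zero_mul] at hrel
  have e1 : A * M * (B⁻¹ * A) = A := by rw [mul_assoc, hMBA, mul_one]
  have e2 : A * M ^ 2 * (B⁻¹ * A) = B := by rw [pow_two, mul_assoc, mul_assoc, hMBA, mul_one, hAM]
  have e3 : A * M ^ 3 * (B⁻¹ * A) = B * A⁻¹ * B := by
    rw [pow_succ, mul_assoc, mul_assoc, hMBA, mul_one, pow_two, ← mul_assoc, hAM, hM, mul_assoc]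
  rw [e1, e2, e3, ← mul_assoc] at hrel
  refine ⟨-M.charpoly.coeff 1 • A + -M.charpoly.coeff 0 • (A * B⁻¹ * A), _, _,
    M.charpoly.coeff 2, 1, ?_, neg_ne_zero.2 h0, one_ne_zero, rfl, ?_⟩
  · refine (hA.smul _).add (IsSymm.smul ?_ _)
    rw [IsSymm, transpose_mul, transpose_mul, transpose_nonsing_inv, hA.eq, hB.eq, mul_assoc]
  · rw [one_smul]
    rw [← sub_eq_zero, ← neg_eq_zero, ← hrel]
    simp only [neg_smul]
    abel

open Matrix in
/-- A conic `G = a A + b A B⁻¹ A` passes through the points of contact with `A` of the common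
tangents of `A` and `B`. -/
lemma tangency_conic_isotropic {A B G : Matrix (Fin 3) (Fin 3) ℂ} (hA : A.IsSymm)
    (hBd : B.det ≠ 0) {a b r : ℂ} (hG : G = a • A + b • (A * B⁻¹ * A)) {p q : Fin 3 → ℂ}
    (hr : r ≠ 0) (hq : B *ᵥ q = r • A *ᵥ p) (hp : p ⬝ᵥ A *ᵥ p = 0) (hqq : q ⬝ᵥ B *ᵥ q = 0) :
    p ⬝ᵥ G *ᵥ p = 0 := by
  have hBA : B⁻¹ *ᵥ (A *ᵥ p) = r⁻¹ • q := by
    have h := congrArg (fun v => r⁻¹ • B⁻¹ *ᵥ v) hq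
    simpa [mulVec_mulVec, nonsing_inv_mul _ (isUnit_iff_ne_zero.2 hBd), mulVec_smul, smul_smul, hr]
      using h.symm
  have h1 : p ⬝ᵥ A *ᵥ q = 0 := by
    rw [dotProduct_mulVec_comm_of_isSymm_s15 hA]
    rw [hq] at hqq
    simpa [hr] using hqq
  simp [hG, add_mulVec, smul_mulVec, ← mulVec_mulVec, hBA, mulVec_smul, hp, h1]

open Matrix in
/-- If the conic `G = a A + b A B⁻¹ A` is tangent to `A` at the point of contact of a common
tangent of `A` and `B`, then this tangent touches `A` and `B` at the same point. -/
lemma eq_smul_of_tangency_conic_tangent {A B G : Matrix (Fin 3) (Fin 3) ℂ} (hAd : A.det ≠ 0)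
    (hBd : B.det ≠ 0) {a b r t : ℂ} (hb : b ≠ 0) (hG : G = a • A + b • (A * B⁻¹ * A))
    {p q : Fin 3 → ℂ} (hr : r ≠ 0) (hq : B *ᵥ q = r • A *ᵥ p) (hGp : G *ᵥ p = t • A *ᵥ p) :
    ∃ s : ℂ, q = s • p := by
  have hBA : B⁻¹ *ᵥ (A *ᵥ p) = r⁻¹ • q := by
    have h := congrArg (fun v => r⁻¹ • B⁻¹ *ᵥ v) hq
    simpa [mulVec_mulVec, nonsing_inv_mul _ (isUnit_iff_ne_zero.2 hBd), mulVec_smul, smul_smul, hr]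
      using h.symm
  refine ⟨r * b⁻¹ * (t - a), ?_⟩
  apply mulVec_injective_iff_isUnit.2 ((isUnit_iff_isUnit_det A).2 (isUnit_iff_ne_zero.2 hAd))
  simp only [hG, add_mulVec, smul_mulVec, ← mulVec_mulVec, hBA, mulVec_smul] at hGp ⊢
  ext m
  have h := congrFun hGp m
  simp only [Pi.add_apply, Pi.smul_apply, smul_eq_mul] at h ⊢
  field_simp at h ⊢
  linear_combination h

/-- The linear form with coefficient vector `u`. -/
def linPoly (u : Fin 3 → ℂ) : MvPolynomial (Fin 3) ℂ := ∑ i, C (u i) * X i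

/-- The quadratic form with Gram matrix `A`. -/
def quadPoly (A : Matrix (Fin 3) (Fin 3) ℂ) : MvPolynomial (Fin 3) ℂ :=
  ∑ i, ∑ j, C (A i j) * X i * X j

open Matrix in
lemma eval_linPoly (u v : Fin 3 → ℂ) : eval v (linPoly u) = u ⬝ᵥ v := by
  simp [linPoly, dotProduct]

lemma pderiv_linPoly (u : Fin 3 → ℂ) (m : Fin 3) : pderiv m (linPoly u) = C (u m) := by
  simp [linPoly, Derivation.leibniz, pderiv_X, Pi.single_apply]

open Matrix in
lemma eval_quadPoly (A : Matrix (Fin 3) (Fin 3) ℂ) (v : Fin 3 → ℂ) :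
    eval v (quadPoly A) = v ⬝ᵥ A *ᵥ v := by
  simp only [quadPoly, dotProduct, mulVec, map_sum, map_mul, eval_C, eval_X, Finset.mul_sum]
  exact Finset.sum_congr rfl fun i _ => Finset.sum_congr rfl fun j _ => by ring

lemma isHomogeneous_quadPoly (A : Matrix (Fin 3) (Fin 3) ℂ) : (quadPoly A).IsHomogeneous 2 :=
  IsHomogeneous.sum _ _ _ fun i _ => IsHomogeneous.sum _ _ _ fun j _ => by
    simpa using ((isHomogeneous_C (Fin 3) (A i j)).mul (isHomogeneous_X ℂ i)).mul
      (isHomogeneous_X ℂ j)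

open Matrix in
lemma eval_pderiv_quadPoly {A : Matrix (Fin 3) (Fin 3) ℂ} (hA : A.IsSymm) (v : Fin 3 → ℂ)
    (m : Fin 3) : eval v (pderiv m (quadPoly A)) = 2 * (A *ᵥ v) m := by
  have h01 := hA.apply 0 1
  have h02 := hA.apply 0 2
  have h12 := hA.apply 1 2
  fin_cases m <;>
    simp [quadPoly, mulVec, dotProduct, Fin.sum_univ_three, Derivation.leibniz, pderiv_X,
      h01, h02, h12] <;> ring

lemma exists_eq_linPoly {f : MvPolynomial (Fin 3) ℂ} (hf : f.IsHomogeneous 1) :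
    ∃ u, f = linPoly u := by
  have h : ∀ m, ∃ c : ℂ, pderiv m f = C c := fun m => by
    have := (totalDegree_zero_iff_isHomogeneous _).2 (hf.pderiv (i := m))
    exact ⟨_, totalDegree_eq_zero_iff_eq_C.1 this⟩
  choose u hu using h
  refine ⟨u, ?_⟩
  have := hf.sum_X_mul_pderiv
  simp only [hu, one_smul] at this
  rw [← this, linPoly]
  exact Finset.sum_congr rfl fun i _ => mul_comm _ _

open Matrix in
lemma exists_eq_quadPoly {f : MvPolynomial (Fin 3) ℂ} (hf : f.IsHomogeneous 2) :
    ∃ A : Matrix (Fin 3) (Fin 3) ℂ, A.IsSymm ∧ f = quadPoly A := by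
  choose B hB using fun m : Fin 3 => exists_eq_linPoly (hf.pderiv (i := m))
  refine ⟨Matrix.of fun i j => (B i j + B j i) / 4, ?_, ?_⟩
  · ext i j
    simp [add_comm]
  · have h := hf.sum_X_mul_pderiv
    simp only [hB, linPoly, Fin.sum_univ_three] at h
    have h4 : (C (1 / 2) : MvPolynomial (Fin 3) ℂ) * (2 • f) = f := by
      rw [two_smul, ← two_mul, ← mul_assoc]
      have : (2 : MvPolynomial (Fin 3) ℂ) = C 2 := (map_ofNat C 2).symm
      rw [this, ← C_mul]
      norm_num
    rw [← h4, ← h]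
    have hC : ∀ a b : ℂ, (C ((a + b) / 4) : MvPolynomial (Fin 3) ℂ) =
        C (1 / 2) * C (1 / 2) * (C a + C b) := by
      intro a b
      rw [← C_mul, ← C_add, ← C_mul]
      congr 1
      ring
    have hhalf : (C (1 / 2) : MvPolynomial (Fin 3) ℂ) * 2 = 1 := by
      have : (2 : MvPolynomial (Fin 3) ℂ) = C 2 := (map_ofNat C 2).symm
      rw [this, ← C_mul]
      norm_num
    simp only [quadPoly, Fin.sum_univ_three, of_apply, hC]
    generalize (C (1 / 2) : MvPolynomial (Fin 3) ℂ) = c at *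
    linear_combination (-c * (X 0 * (C (B 0 0) * X 0 + C (B 0 1) * X 1 + C (B 0 2) * X 2) +
      X 1 * (C (B 1 0) * X 0 + C (B 1 1) * X 1 + C (B 1 2) * X 2) +
      X 2 * (C (B 2 0) * X 0 + C (B 2 1) * X 1 + C (B 2 2) * X 2))) * hhalf

lemma pointIdeal_le_ker (P : P2) : pointIdeal P ≤ RingHom.ker (eval P.rep) :=
  Ideal.span_le.2 fun _ h => h.2

lemma ordGE_zero (f : MvPolynomial (Fin 3) ℂ) (P : P2) (g : MvPolynomial (Fin 3) ℂ) :
    OrdGE f P g 0 :=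
  ⟨1, 0, isHomogeneous_one _ _, by simp [pev], by simp⟩

lemma ordGE_one_quadPoly (f : MvPolynomial (Fin 3) ℂ) {P : P2} {A : Matrix (Fin 3) (Fin 3) ℂ}
    (h : pev (quadPoly A) P = 0) : OrdGE f P (quadPoly A) 1 := by
  refine ⟨1, 0, isHomogeneous_one _ _, by simp [pev], ?_⟩
  rw [one_mul, pow_one]
  apply Ideal.mem_sup_right
  obtain ⟨a, ha⟩ := Function.ne_iff.1 P.rep_nonzero
  rw [Pi.zero_apply] at ha
  set p := P.rep with hp
  have hlin : ∀ b, C (p a) * X b - C (p b) * X a ∈ pointIdeal P := by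
    intro b
    refine Ideal.subset_span ⟨?_, ?_⟩
    · apply IsHomogeneous.sub
      · simpa using (isHomogeneous_C (Fin 3) (p a)).mul (isHomogeneous_X ℂ b)
      · simpa using (isHomogeneous_C (Fin 3) (p b)).mul (isHomogeneous_X ℂ a)
    · simp [pev, ← hp, mul_comm]
  rw [← Ideal.Quotient.eq_zero_iff_mem]
  set φ := Ideal.Quotient.mk (pointIdeal P) with hφ
  have hq : ∀ b, φ (C (p a)) * φ (X b) = φ (C (p b)) * φ (X a) := by
    intro b
    rw [← map_mul, ← map_mul]
    exact Ideal.Quotient.eq.2 (hlin b)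
  have hunit : IsUnit (φ (C (p a)) * φ (C (p a))) := by
    rw [← map_mul, ← C_mul]
    exact ((isUnit_iff_ne_zero.2 (mul_ne_zero ha ha)).map C).map φ
  have hev : φ (C (pev (quadPoly A) P)) * (φ (X a) * φ (X a)) =
      (φ (C (p a)) * φ (C (p a))) * φ (quadPoly A) := by
    simp only [pev, quadPoly, map_sum, map_mul, eval_C, eval_X, ← hp, Finset.sum_mul,
      Finset.mul_sum]
    refine Finset.sum_congr rfl fun i _ => Finset.sum_congr rfl fun j _ => ?_
    linear_combination (-φ (C (A i j)) * φ (C (p a)) * φ (X j)) * hq i -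
      φ (C (A i j)) * φ (C (p i)) * φ (X a) * hq j
  rw [h] at hev
  simp only [map_zero, zero_mul] at hev
  exact (hunit.mul_right_eq_zero).1 hev.symm

lemma not_ordGE_one {f g : MvPolynomial (Fin 3) ℂ} {P : P2} (hf : pev f P = 0)
    (hg : pev g P ≠ 0) : ¬ OrdGE f P g 1 := by
  rintro ⟨h, e, -, hh, hmem⟩
  rw [pow_one] at hmem
  have hle : Ideal.span {f} ⊔ pointIdeal P ≤ RingHom.ker (eval P.rep) :=
    sup_le ((Ideal.span_singleton_le_iff_mem _).2 hf) (pointIdeal_le_ker P)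
  have h0 := hle hmem
  rw [RingHom.mem_ker, map_mul] at h0
  exact mul_ne_zero hh hg h0

lemma not_ordGE_two {f g : MvPolynomial (Fin 3) ℂ} {P : P2} (hf : pev f P = 0)
    (hg : pev g P = 0)
    (hfg : ¬ ∃ c : ℂ, ∀ m, pev (pderiv m g) P = c * pev (pderiv m f) P) :
    ¬ OrdGE f P g (1 + 1) := by
  rintro ⟨h, e, -, hh, hmem⟩
  obtain ⟨y, hy, z, hz, hyz⟩ := Submodule.mem_sup.1 hmem
  obtain ⟨k, rfl⟩ := Ideal.mem_span_singleton'.1 hy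
  have hz0 : ∀ m, eval P.rep (pderiv m z) = 0 := by
    intro m
    rw [one_add_one_eq_two, pow_two] at hz
    refine Submodule.mul_induction_on hz (fun a ha b hb => ?_) fun a b ha hb => by simp [ha, hb]
    have ha' : eval P.rep a = 0 := pointIdeal_le_ker P ha
    have hb' : eval P.rep b = 0 := pointIdeal_le_ker P hb
    simp [Derivation.leibniz, ha', hb']
  apply hfg
  refine ⟨eval P.rep k / eval P.rep h, fun m => ?_⟩
  have hd := congrArg (fun t => eval P.rep (pderiv m t)) hyz
  simp only [pev] at hf hg hh ⊢
  simp [Derivation.leibniz, hf, hg, hz0] at hd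
  field_simp
  linear_combination -hd

lemma P2.eq_of_rep_eq_smul {P Q : P2} {c : ℂ} (h : P.rep = c • Q.rep) : P = Q := by
  rw [← P.mk_rep, ← Q.mk_rep, Projectivization.mk_eq_mk_iff']
  exact ⟨c, h.symm⟩

open Matrix in
/-- A common tangent line of two smooth conics is one of four given ones. -/
lemma exists_eq_smul_of_common_tangent {A B : Matrix (Fin 3) (Fin 3) ℂ} (hA : A.IsSymm)
    (hB : B.IsSymm) (hAd : A.det ≠ 0) (hBd : B.det ≠ 0) (hAB : ∀ c : ℂ, A ≠ c • B)
    {u : Fin 4 → Fin 3 → ℂ} (hu : ∀ i j, i ≠ j → ∀ c : ℂ, u i ≠ c • u j)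
    (huA : ∀ i, u i ⬝ᵥ A⁻¹ *ᵥ u i = 0) (huB : ∀ i, u i ⬝ᵥ B⁻¹ *ᵥ u i = 0) {y : Fin 3 → ℂ}
    (hyA : y ⬝ᵥ A⁻¹ *ᵥ y = 0) (hyB : y ⬝ᵥ B⁻¹ *ᵥ y = 0) :
    ∃ (i : Fin 4) (c : ℂ), y = c • u i := by
  by_contra! hcon
  have hcon' : ∀ i, ∀ c : ℂ, u i ≠ c • y := by
    intro i c h
    by_cases hc : c = 0
    · obtain ⟨j, hj⟩ := exists_ne i
      exact hu i j hj.symm 0 (by rw [h, hc, zero_smul, zero_smul])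
    · exact hcon i c⁻¹ (by rw [h, smul_smul, inv_mul_cancel₀ hc, one_smul])
  have hAu : IsUnit A.det := isUnit_iff_ne_zero.2 hAd
  have hBu : IsUnit B.det := isUnit_iff_ne_zero.2 hBd
  obtain ⟨c, hc⟩ := exists_eq_smul_of_isotropic (B := A⁻¹) (D := B⁻¹)
    (w := Fin.cons y u) (by rw [IsSymm, transpose_nonsing_inv, hA.eq])
    (by rw [IsSymm, transpose_nonsing_inv, hB.eq])
    (by rw [det_nonsing_inv]; simpa using hAd)
    (by
      intro i j hij
      cases i using Fin.cases <;> cases j using Fin.cases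
      · exact absurd rfl hij
      · exact hcon _
      · exact hcon' _
      · exact hu _ _ fun h => hij (congrArg Fin.succ h))
    (by intro i; cases i using Fin.cases <;> [exact hyA; exact huA _])
    (by intro i; cases i using Fin.cases <;> [exact hyB; exact huB _])
  apply hAB c
  calc A = B * B⁻¹ * A := by rw [mul_nonsing_inv _ hBu, one_mul]
    _ = c • B := by
      rw [hc, mul_smul_comm, smul_mul_assoc, mul_assoc, nonsing_inv_mul _ hAu, mul_one]

open Matrix in
lemma dotProduct_inv_mulVec_self {A : Matrix (Fin 3) (Fin 3) ℂ}
    (hAd : A.det ≠ 0) (p : Fin 3 → ℂ) : (A *ᵥ p) ⬝ᵥ A⁻¹ *ᵥ (A *ᵥ p) = p ⬝ᵥ A *ᵥ p := by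
  rw [mulVec_mulVec, nonsing_inv_mul _ (isUnit_iff_ne_zero.2 hAd), one_mulVec, dotProduct_comm]

open Matrix in
lemma det_ne_zero_of_smooth {A : Matrix (Fin 3) (Fin 3) ℂ} (hA : A.IsSymm)
    (h : ∀ x : P2, pev (quadPoly A) x = 0 → ∃ m : Fin 3, pev (pderiv m (quadPoly A)) x ≠ 0) :
    A.det ≠ 0 := by
  intro hdet
  obtain ⟨v, hv, hAv⟩ := exists_mulVec_eq_zero_iff.2 hdet
  obtain ⟨a, ha⟩ := Projectivization.exists_smul_eq_mk_rep ℂ v hv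
  have hrep : A *ᵥ (Projectivization.mk ℂ v hv).rep = 0 := by
    rw [← ha, mulVec_smul, hAv, smul_zero]
  obtain ⟨m, hm⟩ := h (Projectivization.mk ℂ v hv) (by
    rw [pev, eval_quadPoly, hrep, dotProduct_zero])
  apply hm
  rw [pev, eval_pderiv_quadPoly hA, hrep]
  simp

/-- The section of `𝒪(d)|_C` defined by a form `g` of degree `d`. -/
def formSection (C : Set P2) (d : ℕ) (g : MvPolynomial (Fin 3) ℂ) : TrivData (OdC C d) where
  σ := Fin 3
  K a := X a
  Kdeg _ := 1
  toChart a := a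
  lnum _ := g
  lden a := X a ^ d
  ldeg _ := d

lemma formSection_validSection (C : Set P2) {d : ℕ} {g : MvPolynomial (Fin 3) ℂ}
    (hg : g.IsHomogeneous d) : (formSection C d g).ValidSection := by
  have hX : ∀ a : Fin 3, ((X a : MvPolynomial (Fin 3) ℂ) ^ d).IsHomogeneous d := fun a => by
    simpa using (isHomogeneous_X ℂ a).pow d
  refine ⟨fun c => isHomogeneous_X ℂ c, fun x _ => ?_, fun c x _ h => h, fun c => ⟨hg, ?_⟩,
    fun c x _ h => ?_, fun c c' x _ _ _ => ?_⟩
  · obtain ⟨a, ha⟩ := Function.ne_iff.1 x.rep_nonzero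
    exact ⟨a, by simpa [formSection, pev] using ha⟩
  · exact hX c
  · simp only [formSection, pev, map_pow] at h ⊢
    exact pow_ne_zero _ h
  · simp only [formSection, OdC, pev]
    ring

open scoped Matrix

/-- **Salmon's theorem.** Let `C₁, C₂ ⊂ ℙ²(ℂ)` be smooth conics intersecting
transversely, let `T₁, …, T₄` be their four common bitangent lines, and let
`P_{ik} = T_i ∩ C_k` be the eight points of tangency.  Then
`𝒪_C(∑_{i=1}^{4}(P_{i1}+P_{i2})) ≅ 𝒪_{ℙ²}(2)|_C` where `C = C₁ + C₂` (i.e. `𝒪(2)|_C` has a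
global section whose divisor is the sum of the eight tangency points); in particular the
eight tangency points all lie on a single conic in `ℙ²`. -/
theorem statement15 (A : ConicLineArrangement 2) (hdeg : ∀ i, A.deg i = 2)
    (l : Fin 4 → MvPolynomial (Fin 3) ℂ)
    (hlhom : ∀ i, (l i).IsHomogeneous 1) (hlne : ∀ i, l i ≠ 0)
    (hldist : ∀ i j, i ≠ j → zeroLocus (l i) ≠ zeroLocus (l j))
    (Pt : Fin 4 → Fin 2 → P2)
    (htan : ∀ i kk, IsTangentLineAt (l i) (A.f kk) (Pt i kk)) :
    (∀ E : P2 →₀ ℕ, IsAllTangencyDivisor Pt E →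
      HasSectionWithDivisor A.plane (A.f 0 * A.f 1) (OdC A.plane 2) E) ∧
    (∃ g : MvPolynomial (Fin 3) ℂ, g.IsHomogeneous 2 ∧ g ≠ 0 ∧
      ∀ (i : Fin 4) (kk : Fin 2), pev g (Pt i kk) = 0) := by
  choose F hFs hF using fun k => exists_eq_quadPoly (hdeg k ▸ A.homog k)
  choose u hu using fun i => exists_eq_linPoly (hlhom i)
  have hFd : ∀ k, (F k).det ≠ 0 := fun k =>
    det_ne_zero_of_smooth (hFs k) (by rw [← hF k]; exact A.smooth k)
  have hne : ∀ {k k' : Fin 2}, k ≠ k' → ∀ c : ℂ, F k ≠ c • F k' := by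
    intro k k' hkk c hc
    have hc0 : c ≠ 0 := by
      rintro rfl
      apply hFd k
      rw [hc, zero_smul, Matrix.det_zero]
    apply A.distinct k k' hkk
    ext x
    simp [_root_.zeroLocus, pev, hF, eval_quadPoly, hc, Matrix.smul_mulVec, hc0]
  have hupair : ∀ i j, i ≠ j → ∀ c : ℂ, u i ≠ c • u j := by
    intro i j hij c hc
    have hc0 : c ≠ 0 := by
      rintro rfl
      apply hlne i
      rw [hu i, hc]
      simp [linPoly]
    apply hldist i j hij
    ext x
    simp [_root_.zeroLocus, pev, hu, eval_linPoly, hc, hc0]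
  have hiso : ∀ i k, (Pt i k).rep ⬝ᵥ F k *ᵥ (Pt i k).rep = 0 := by
    intro i k
    have h := (htan i k).2.1
    rwa [hF, pev, eval_quadPoly] at h
  have hFinj : ∀ k, Function.Injective (F k).mulVec := fun k =>
    Matrix.mulVec_injective_iff_isUnit.2
      ((Matrix.isUnit_iff_isUnit_det _).2 (isUnit_iff_ne_zero.2 (hFd k)))
  have hgrad : ∀ i k, ∃ c : ℂ, c ≠ 0 ∧ F k *ᵥ (Pt i k).rep = c • u i := by
    intro i k
    obtain ⟨c, hc⟩ := (htan i k).2.2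
    have h : F k *ᵥ (Pt i k).rep = (c / 2) • u i := by
      ext m
      have h := hc m
      rw [hF, hu, pev, pev, eval_pderiv_quadPoly (hFs k), pderiv_linPoly, eval_C] at h
      rw [Pi.smul_apply, smul_eq_mul]
      linear_combination h / 2
    refine ⟨c / 2, fun h0 => ?_, h⟩
    rw [h0, zero_smul] at h
    exact (Pt i k).rep_nonzero (hFinj k (by rw [h, Matrix.mulVec_zero]))
  choose g hg0 hg using hgrad
  have hpol : ∀ i k k', F k' *ᵥ (Pt i k').rep = (g i k' / g i k) • F k *ᵥ (Pt i k).rep := by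
    intro i k k'
    rw [hg, hg, smul_smul, div_mul_cancel₀ _ (hg0 i k)]
  have hpol0 : ∀ i k k', g i k' / g i k ≠ 0 := fun i k k' => div_ne_zero (hg0 _ _) (hg0 _ _)
  have hoff : ∀ i {k k' : Fin 2}, k ≠ k' → pev (A.f k') (Pt i k) ≠ 0 := by
    intro i k k' hkk h0
    have h0' := h0
    rw [hF, pev, eval_quadPoly] at h0'
    have hline : u i ⬝ᵥ (Pt i k).rep = 0 := by
      have h := (htan i k).1
      rwa [hu, pev, eval_linPoly] at h
    have hmix : (Pt i k).rep ⬝ᵥ F k' *ᵥ (Pt i k').rep = 0 := by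
      rw [hg, dotProduct_smul, dotProduct_comm, hline, smul_zero]
    have hsame : Pt i k' = Pt i k := by
      by_contra hPP
      refine crossProduct_ne_zero_of_forall_ne_smul (Pt i k).rep_nonzero (fun c hc => ?_)
        (crossProduct_eq_zero_of_isotropic (hFs k') (hFd k') h0' (hiso i k') hmix)
      exact hPP (P2.eq_of_rep_eq_smul hc)
    refine (A.nodes k k' hkk (Pt i k) ⟨(htan i k).2.1, h0⟩).2 ⟨g i k' / g i k, fun m => ?_⟩
    have h := congrFun (hpol i k k') m
    rw [hsame, Pi.smul_apply, smul_eq_mul] at h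
    rw [hF, hF, pev, pev, eval_pderiv_quadPoly (hFs _), eval_pderiv_quadPoly (hFs _), h]
    ring
  have hPtinj : ∀ i j k k', Pt i k = Pt j k' → i = j ∧ k = k' := by
    intro i j k k' h
    have hk : k = k' := by
      by_contra hk
      apply hoff i hk
      rw [h]
      exact (htan j k').2.1
    subst hk
    refine ⟨?_, rfl⟩
    by_contra hij
    have h' : g i k • u i = g j k • u j := by rw [← hg, ← hg, h]
    apply hupair i j hij ((g i k)⁻¹ * g j k)
    rw [mul_smul, ← h', smul_smul, inv_mul_cancel₀ (hg0 i k), one_smul]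
  obtain ⟨G, a, b, c, d, hGs, hb, hd, hG0, hG1⟩ :=
    exists_tangency_conic (hFs 0) (hFs 1) (hFd 0) (hFd 1)
  have hG : ∀ k k' : Fin 2, k ≠ k' →
      ∃ a b : ℂ, b ≠ 0 ∧ G = a • F k + b • (F k * (F k')⁻¹ * F k) := by
    intro k k' hkk
    fin_cases k <;> fin_cases k' <;> first | exact absurd rfl hkk | skip
    · exact ⟨a, b, hb, hG0⟩
    · exact ⟨c, d, hd, hG1⟩
  have hother : ∀ k : Fin 2, ∃ k', k ≠ k' ∧ A.f 0 * A.f 1 = A.f k * A.f k' := by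
    intro k
    fin_cases k
    · exact ⟨1, by decide, rfl⟩
    · exact ⟨0, by decide, mul_comm _ _⟩
  have hpass : ∀ i k, pev (quadPoly G) (Pt i k) = 0 := by
    intro i k
    obtain ⟨k', hkk, -⟩ := hother k
    obtain ⟨a, b, hb, hGk⟩ := hG k k' hkk
    rw [pev, eval_quadPoly]
    exact tangency_conic_isotropic (hFs k) (hFd k') hGk (hpol0 i k k') (hpol i k k') (hiso i k)
      (hiso i k')
  have hnottan : ∀ i k (t : ℂ), G *ᵥ (Pt i k).rep ≠ t • F k *ᵥ (Pt i k).rep := by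
    intro i k t ht
    obtain ⟨k', hkk, -⟩ := hother k
    obtain ⟨a, b, hb, hGk⟩ := hG k k' hkk
    obtain ⟨s, hs⟩ := eq_smul_of_tangency_conic_tangent (hFd k) (hFd k') hb hGk
      (hpol0 i k k') (hpol i k k') ht
    exact hkk (hPtinj _ _ _ _ (P2.eq_of_rep_eq_smul hs)).2.symm
  have hdual : ∀ k i, u i ⬝ᵥ (F k)⁻¹ *ᵥ u i = 0 := by
    intro k i
    have h := dotProduct_inv_mulVec_self (hFd k) (Pt i k).rep
    rw [hiso, hg] at h
    simpa [Matrix.mulVec_smul, hg0] using h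
  have honly : ∀ (k : Fin 2) (P : P2), pev (A.f k) P = 0 → pev (quadPoly G) P = 0 →
      ∃ i, P = Pt i k := by
    intro k P hP hGP
    obtain ⟨k', hkk, -⟩ := hother k
    obtain ⟨a, b, hb, hGk⟩ := hG k k' hkk
    rw [hF, pev, eval_quadPoly] at hP
    rw [pev, eval_quadPoly] at hGP
    have hy' : (F k *ᵥ P.rep) ⬝ᵥ (F k')⁻¹ *ᵥ (F k *ᵥ P.rep) = 0 := by
      rw [hGk, Matrix.add_mulVec, Matrix.smul_mulVec, Matrix.smul_mulVec, dotProduct_add,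
        dotProduct_smul, dotProduct_smul, hP, smul_zero, zero_add, smul_eq_mul,
        ← Matrix.mulVec_mulVec, ← Matrix.mulVec_mulVec,
        dotProduct_mulVec_comm_of_isSymm_s15 (hFs k)] at hGP
      rw [dotProduct_comm]
      exact (mul_eq_zero.1 hGP).resolve_left hb
    obtain ⟨i, t, ht⟩ := exists_eq_smul_of_common_tangent (hFs k) (hFs k') (hFd k) (hFd k')
      (hne hkk) hupair (hdual k) (hdual k') (y := F k *ᵥ P.rep)
      (by rw [dotProduct_inv_mulVec_self (hFd k), hP]) hy'
    refine ⟨i, P2.eq_of_rep_eq_smul (c := t * (g i k)⁻¹) (hFinj k ?_)⟩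
    rw [ht, Matrix.mulVec_smul, hg, smul_smul, mul_assoc, inv_mul_cancel₀ (hg0 i k), mul_one]
  have hplane : ∀ P ∈ A.plane, ∃ k, pev (A.f k) P = 0 := by
    intro P hP
    obtain ⟨k, hk⟩ := Set.mem_iUnion.1 (show P ∈ ⋃ k, A.curve k from hP)
    exact ⟨k, hk⟩
  have hzero : ∀ P ∈ A.plane, pev (A.f 0 * A.f 1) P = 0 := by
    intro P hP
    obtain ⟨k, hk⟩ := hplane P hP
    obtain ⟨k', -, hprod⟩ := hother k
    rw [pev] at hk
    rw [hprod, pev, map_mul, hk, zero_mul]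
  have hmem : ∀ i k, Pt i k ∈ A.plane := fun i k => Set.mem_iUnion.2 ⟨k, (htan i k).2.1⟩
  refine ⟨fun E hE => ⟨formSection _ 2 (quadPoly G),
    formSection_validSection _ (isHomogeneous_quadPoly G), ?_, ?_⟩,
    quadPoly G, isHomogeneous_quadPoly G, ?_, hpass⟩
  · intro P hP
    by_contra hPC
    apply hP
    rw [hE P]
    refine Finset.sum_eq_zero fun i _ => Finset.sum_eq_zero fun k _ => if_neg ?_
    rintro rfl
    exact hPC (hmem i k)
  · intro P hP _ _
    change OrdEq _ P (quadPoly G) _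
    by_cases hPt : ∃ i k, P = Pt i k
    · obtain ⟨i, k, rfl⟩ := hPt
      have hE1 : E (Pt i k) = 1 := by
        rw [hE, Finset.sum_eq_single i, Finset.sum_eq_single k, if_pos rfl]
        · exact fun k' _ hk => if_neg fun h => hk (hPtinj _ _ _ _ h).2.symm
        · simp
        · exact fun j _ hj => Finset.sum_eq_zero fun k' _ =>
            if_neg fun h => hj (hPtinj _ _ _ _ h).1.symm
        · simp
      rw [hE1]
      refine ⟨ordGE_one_quadPoly _ (hpass i k), not_ordGE_two (hzero _ hP) (hpass i k) ?_⟩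
      rintro ⟨t, ht⟩
      obtain ⟨k', hkk, hprod⟩ := hother k
      refine hnottan i k (t * pev (A.f k') (Pt i k)) ?_
      ext m
      have h := ht m
      have hk0 : eval (Pt i k).rep (A.f k) = 0 := (htan i k).2.1
      have hdk : eval (Pt i k).rep (pderiv m (A.f k)) = 2 * (F k *ᵥ (Pt i k).rep) m := by
        rw [hF, eval_pderiv_quadPoly (hFs k)]
      rw [hprod, pev, pev, eval_pderiv_quadPoly hGs, Derivation.leibniz, map_add, smul_eq_mul,
        smul_eq_mul, map_mul, map_mul, hk0, hdk] at h
      rw [Pi.smul_apply, smul_eq_mul, pev]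
      linear_combination h / 2
    · have hE0 : E P = 0 := by
        rw [hE]
        exact Finset.sum_eq_zero fun i _ => Finset.sum_eq_zero fun k _ =>
          if_neg fun h => hPt ⟨i, k, h⟩
      rw [hE0]
      refine ⟨ordGE_zero _ _ _, not_ordGE_one (hzero _ hP) fun h => ?_⟩
      obtain ⟨k, hk⟩ := hplane P hP
      obtain ⟨i, hi⟩ := honly k P hk h
      exact hPt ⟨i, k, hi⟩
  · intro h0
    refine hnottan 0 0 0 ?_
    ext m
    have h := eval_pderiv_quadPoly hGs (Pt 0 0).rep m
    rw [h0, map_zero, map_zero] at h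
    rw [zero_smul, Pi.zero_apply]
    linear_combination -h / 2

end Statement15

end
end
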